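/- arXiv:1407.4688 — 2 statements merged into one kernel-verified Lean document; each statement's English description precedes it below -/
import Mathlib

section
/- As z → 1⁻ (z real), f(z)² + f(z²) ~ 1/((1−z)²·log²(1/(1−z))), i.e. (1−z)²·log²(1/(1−z))·(f(z)² + f(z²)) → 1. -/
open Filter Topology

/-- `f z = ∑_{p odd prime} z^p`. -/
noncomputable def f (z : ℝ) : ℝ := ∑' p : ℕ, if Nat.Prime p ∧ Odd p then z ^ p else 0

open MeasureTheory Complex in
open scoped FourierTransform SchwartzMap in
lemma tendsto_integral_mul_fourier_of_boundary {D : ℝ → ℂ} {G : ℂ → ℂ} {M : ℝ}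
    (hDc : Continuous D) (hDb : ∀ ε ∈ Set.Icc (0 : ℝ) 1, ∀ u, ‖Real.exp (-ε * u) • D u‖ ≤ M)
    (hDi : ∀ ε ∈ Set.Ioc (0 : ℝ) 1, Integrable fun u ↦ Real.exp (-ε * u) • D u)
    (hG : ContinuousOn G {s | 0 ≤ s.re})
    (hDG : ∀ ε ∈ Set.Ioc (0 : ℝ) 1, ∀ t : ℝ,
      𝓕 (fun u : ℝ ↦ Real.exp (-ε * u) • D u) t = G (ε + 2 * Real.pi * t * I))
    (φ : 𝓢(ℝ, ℂ)) (hφ : HasCompactSupport φ) :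
    Tendsto (fun x ↦ ∫ w, D (x + w) * 𝓕 (φ : ℝ → ℂ) w) atTop (𝓝 0) := by
  have hline : ∀ ε : ℝ, 0 ≤ ε → Continuous fun t : ℝ ↦ G (ε + 2 * Real.pi * t * I) := fun ε hε ↦
    hG.comp_continuous (by fun_prop) (by simp [hε])
  have hFi : Integrable (𝓕 (φ : ℝ → ℂ)) := (𝓕 φ).integrable
  have key : ∀ x : ℝ, ∫ w, D (x + w) * 𝓕 (φ : ℝ → ℂ) w =
      𝓕 (fun t : ℝ ↦ G (2 * Real.pi * t * I) * φ t) (-x) := by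
    intro x
    have shift : ∀ u : ℝ, 𝓕 (fun t : ℝ ↦ 𝐞 (t * x) • φ t) u = 𝓕 (φ : ℝ → ℂ) (u - x) := by
      intro u
      simp_rw [Real.fourier_real_eq, smul_smul, ← AddChar.map_add_eq_mul]
      congr! 4
      ring
    have hψi : Integrable (fun t : ℝ ↦ 𝐞 (t * x) • φ t) := by
      have : Continuous fun t : ℝ ↦ 𝐞 (t * x) := by fun_prop
      refine φ.integrable.mono (by fun_prop) (.of_forall fun t ↦ by simp)
    have hmain : ∀ ε ∈ Set.Ioc (0 : ℝ) 1,
        ∫ u, (Real.exp (-ε * u) • D u) * 𝓕 (φ : ℝ → ℂ) (u - x) =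
        ∫ t : ℝ, G (ε + 2 * Real.pi * t * I) * (𝐞 (t * x) • φ t) := by
      intro ε hε
      have := VectorFourier.integral_fourierIntegral_smul_eq_flip (L := innerₗ ℝ)
        Real.continuous_fourierChar continuous_inner (hDi ε hε) hψi
      simp_rw [← hDG ε hε, ← shift]
      simpa using! this.symm
    have hl : Tendsto (fun ε : ℝ ↦ ∫ u, (Real.exp (-ε * u) • D u) * 𝓕 (φ : ℝ → ℂ) (u - x))
        (𝓝[>] 0) (𝓝 (∫ u, D u * 𝓕 (φ : ℝ → ℂ) (u - x))) := by
      have hmem : ∀ᶠ ε in 𝓝[>] (0 : ℝ), ε ∈ Set.Ioc (0 : ℝ) 1 := Ioc_mem_nhdsGT one_pos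
      refine tendsto_integral_filter_of_dominated_convergence
        (fun u ↦ M * ‖𝓕 (φ : ℝ → ℂ) (u - x)‖) ?_ ?_ ?_ ?_
      · refine .of_forall fun ε ↦ ?_
        exact Continuous.aestronglyMeasurable (by
          have := (𝓕 φ).continuous
          rw [SchwartzMap.fourier_coe] at this
          fun_prop)
      · filter_upwards [hmem] with ε hε
        refine .of_forall fun u ↦ ?_
        rw [norm_mul]
        gcongr
        exact hDb ε ⟨hε.1.le, hε.2⟩ u
      · exact (hFi.comp_sub_right x).norm.const_mul M
      · refine .of_forall fun u ↦ ?_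
        have : Continuous fun ε : ℝ ↦ (Real.exp (-ε * u) • D u) * 𝓕 (φ : ℝ → ℂ) (u - x) := by
          fun_prop
        simpa using! (this.tendsto 0).mono_left nhdsWithin_le_nhds
    have hr : Tendsto (fun ε : ℝ ↦ ∫ t : ℝ, G (ε + 2 * Real.pi * t * I) * (𝐞 (t * x) • φ t))
        (𝓝[>] 0) (𝓝 (∫ t : ℝ, G (2 * Real.pi * t * I) * (𝐞 (t * x) • φ t))) := by
      have hmem : ∀ᶠ ε in 𝓝[>] (0 : ℝ), ε ∈ Set.Ioc (0 : ℝ) 1 := Ioc_mem_nhdsGT one_pos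
      have hcpt : IsCompact ((fun p : ℝ × ℝ ↦ (p.1 + 2 * Real.pi * p.2 * I : ℂ)) ''
          (Set.Icc 0 1 ×ˢ tsupport φ)) :=
        (isCompact_Icc.prod hφ).image (by fun_prop)
      obtain ⟨B, hB⟩ := hcpt.exists_bound_of_continuousOn (hG.mono (by
        rintro _ ⟨p, hp, rfl⟩
        simpa using hp.1.1))
      refine tendsto_integral_filter_of_dominated_convergence (fun t ↦ B * ‖φ t‖) ?_ ?_ ?_ ?_
      · filter_upwards [hmem] with ε hε
        have h1 := hline ε hε.1.le
        have h2 : Continuous fun t : ℝ ↦ 𝐞 (t * x) := by fun_prop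
        exact (h1.mul (h2.smul φ.continuous)).aestronglyMeasurable
      · filter_upwards [hmem] with ε hε
        refine .of_forall fun t ↦ ?_
        rw [norm_mul, Circle.norm_smul]
        by_cases ht : t ∈ tsupport φ
        · gcongr
          exact hB _ ⟨(ε, t), ⟨⟨hε.1.le, hε.2⟩, ht⟩, rfl⟩
        · simp [image_eq_zero_of_notMem_tsupport ht]
      · exact φ.integrable.norm.const_mul B
      · refine .of_forall fun t ↦ ?_
        refine Tendsto.mul_const _ ?_
        have h1 : Tendsto (fun ε : ℝ ↦ (ε + 2 * Real.pi * t * I : ℂ)) (𝓝[>] 0)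
            (𝓝[{s | 0 ≤ s.re}] (2 * Real.pi * t * I)) := by
          refine tendsto_nhdsWithin_iff.2 ⟨?_, ?_⟩
          · have : Continuous fun ε : ℝ ↦ (ε + 2 * Real.pi * t * I : ℂ) := by fun_prop
            simpa using! (this.tendsto 0).mono_left nhdsWithin_le_nhds
          · filter_upwards [hmem] with ε hε
            simpa using hε.1.le
        exact (hG _ (by simp)).tendsto.comp h1
    have heq := tendsto_nhds_unique (hl.congr' (by
      filter_upwards [Ioc_mem_nhdsGT one_pos] with ε hε using hmain ε hε)) hr
    rw [← integral_add_left_eq_self _ x] at heq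
    simp only [add_sub_cancel_left] at heq
    rw [heq, Real.fourier_real_eq]
    congr! 2 with t
    simp [Circle.smul_def]
    ring
  simp_rw [key]
  exact (Real.zero_at_infty_fourier _).comp (tendsto_neg_atTop_atBot.mono_right atBot_le_cocompact)

open MeasureTheory Complex in
open scoped ContDiff SchwartzMap in
lemma exists_schwartz_compactSupport_apply_zero_eq_one :
    ∃ φ : 𝓢(ℝ, ℂ), HasCompactSupport φ ∧ φ 0 = 1 := by
  let b : ContDiffBump (0 : ℝ) := ⟨1, 2, one_pos, one_lt_two⟩
  have h1 : HasCompactSupport fun x : ℝ ↦ (b x : ℂ) :=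
    b.hasCompactSupport.comp_left (g := fun y : ℝ ↦ (y : ℂ)) ofReal_zero
  have h2 : ContDiff ℝ ∞ fun x : ℝ ↦ (b x : ℂ) := by
    have hb : ContDiff ℝ ∞ fun x : ℝ ↦ b x := b.contDiff
    exact ofRealCLM.contDiff.comp hb
  refine ⟨h1.toSchwartzMap h2, h1, ?_⟩
  have : b 0 = 1 := b.one_of_mem_closedBall (by simp [b])
  simp [this]

open MeasureTheory Complex in
open scoped FourierTransform SchwartzMap in
lemma tendsto_zero_of_fourier_boundary {D : ℝ → ℂ} {G : ℂ → ℂ} {M : ℝ} {C : NNReal}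
    (hDl : LipschitzWith C D)
    (hDb : ∀ ε ∈ Set.Icc (0 : ℝ) 1, ∀ u, ‖Real.exp (-ε * u) • D u‖ ≤ M)
    (hDi : ∀ ε ∈ Set.Ioc (0 : ℝ) 1, Integrable fun u ↦ Real.exp (-ε * u) • D u)
    (hG : ContinuousOn G {s | 0 ≤ s.re})
    (hDG : ∀ ε ∈ Set.Ioc (0 : ℝ) 1, ∀ t : ℝ,
      𝓕 (fun u : ℝ ↦ Real.exp (-ε * u) • D u) t = G (ε + 2 * Real.pi * t * I)) :
    Tendsto D atTop (𝓝 0) := by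
  obtain ⟨φ, hφ, hφ0⟩ := exists_schwartz_compactSupport_apply_zero_eq_one
  have hcF : Continuous (𝓕 (φ : ℝ → ℂ)) := (𝓕 φ).continuous
  have hF : Integrable (𝓕 (φ : ℝ → ℂ)) := (𝓕 φ).integrable
  have hF1 : Integrable fun w : ℝ ↦ ‖w‖ * ‖𝓕 (φ : ℝ → ℂ) w‖ := by
    have := (𝓕 φ).integrable_pow_mul volume 1
    simp only [pow_one] at this
    exact this
  have hint : ∫ w, 𝓕 (φ : ℝ → ℂ) w = 1 := by
    have h := φ.continuous.fourierInv_fourier_eq φ.integrable hF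
    have := congrFun h 0
    rw [Real.fourierInv_eq'] at this
    simpa [hφ0] using this
  set K := ∫ w : ℝ, ‖w‖ * ‖𝓕 (φ : ℝ → ℂ) w‖ with hK
  have hK0 : 0 ≤ K := integral_nonneg fun w ↦ by positivity
  have hscale : ∀ R : ℝ, 0 < R →
      Tendsto (fun x ↦ ∫ w, D (x + w / R) * 𝓕 (φ : ℝ → ℂ) w) atTop (𝓝 0) := by
    intro R hR
    let e : ℝ ≃L[ℝ] ℝ := ContinuousLinearEquiv.unitsEquivAut ℝ (Units.mk0 R⁻¹ (by positivity))
    have he : ∀ t, e t = t / R := fun t ↦ by simp [e, div_eq_mul_inv]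
    let φR : 𝓢(ℝ, ℂ) := SchwartzMap.compCLMOfContinuousLinearEquiv ℂ e φ
    have hφR : ∀ t, φR t = φ (t / R) := fun t ↦ by simp [φR, he]
    have hsupp : HasCompactSupport φR := hφ.comp_homeomorph e.toHomeomorph
    have h1 : ∀ w, 𝓕 (φR : ℝ → ℂ) w = R * 𝓕 (φ : ℝ → ℂ) (R * w) := by
      intro w
      simp_rw [Real.fourier_real_eq, hφR]
      have := Measure.integral_comp_div (fun t : ℝ ↦ 𝐞 (-(t * (R * w))) • φ t) R
      rw [abs_of_pos hR] at this
      rw [← Complex.real_smul, ← this]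
      congr! 4 with t
      field_simp
    refine (tendsto_integral_mul_fourier_of_boundary hDl.continuous hDb hDi hG hDG φR hsupp).congr
      fun x ↦ ?_
    simp_rw [h1]
    have := Measure.integral_comp_mul_left (fun w : ℝ ↦ D (x + w / R) * 𝓕 (φ : ℝ → ℂ) w) R
    rw [abs_of_pos (by positivity : 0 < R⁻¹), ← inv_smul_eq_iff₀ (by positivity), inv_inv] at this
    rw [← this, ← integral_smul]
    congr! 2 with w
    rw [mul_div_cancel_left₀ _ hR.ne', Complex.real_smul]
    ring
  have hbd : ∀ u, ‖D u‖ ≤ M := fun u ↦ by simpa using hDb 0 (by simp) u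
  have happrox : ∀ R : ℝ, 0 < R → ∀ x, ‖D x‖ ≤
      ‖∫ w, D (x + w / R) * 𝓕 (φ : ℝ → ℂ) w‖ + C * K / R := by
    intro R hR x
    have hcD := hDl.continuous
    have hi1 : Integrable fun w ↦ D (x + w / R) * 𝓕 (φ : ℝ → ℂ) w :=
      hF.bdd_mul (c := M) (Continuous.aestronglyMeasurable (by fun_prop))
        (.of_forall fun w ↦ hbd _)
    have hD : D x = (∫ w, D (x + w / R) * 𝓕 (φ : ℝ → ℂ) w) -
        ∫ w, (D (x + w / R) - D x) * 𝓕 (φ : ℝ → ℂ) w := by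
      simp_rw [sub_mul]
      rw [integral_sub hi1 (hF.const_mul _), integral_const_mul, hint]
      ring
    have hb : ‖∫ w, (D (x + w / R) - D x) * 𝓕 (φ : ℝ → ℂ) w‖ ≤ C * K / R := by
      have : C * K / R = ∫ w : ℝ, C / R * (‖w‖ * ‖𝓕 (φ : ℝ → ℂ) w‖) := by
        rw [integral_const_mul, hK]; ring
      rw [this]
      refine norm_integral_le_of_norm_le (hF1.const_mul _) (.of_forall fun w ↦ ?_)
      rw [norm_mul, ← mul_assoc]
      gcongr
      refine (hDl.norm_sub_le _ _).trans_eq ?_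
      rw [add_sub_cancel_left, norm_div, Real.norm_of_nonneg hR.le]
      ring
    have := (congrArg norm hD).trans_le (norm_sub_le _ _)
    linarith
  rw [tendsto_zero_iff_norm_tendsto_zero, Metric.tendsto_atTop']
  intro η hη
  obtain ⟨R, hR, hRη⟩ : ∃ R : ℝ, 0 < R ∧ C * K / R < η / 2 := by
    refine ⟨2 * (C * K + 1) / η, by positivity, ?_⟩
    rw [div_lt_iff₀ (by positivity)]
    field_simp
    linarith
  obtain ⟨N, hN⟩ := Metric.tendsto_atTop'.1 (hscale R hR) (η / 2) (by positivity)
  refine ⟨N, fun x hx ↦ ?_⟩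
  have h1 := hN x hx
  have h2 := happrox R hR x
  rw [dist_zero_right] at h1 ⊢
  rw [norm_norm]
  linarith

lemma summable_and_tsum_mul_pow_le {a : ℕ → ℝ} (ha : ∀ n, 0 ≤ a n) {c d : ℝ}
    (hS : ∀ n, ∑ k ∈ Finset.range (n + 1), a k ≤ c * n + d) {r : ℝ} (hr0 : 0 ≤ r) (hr1 : r < 1) :
    (Summable fun n ↦ a n * r ^ n) ∧ ∑' n, a n * r ^ n ≤ c * (r / (1 - r)) + d := by
  have hr : ‖r‖ < 1 := by rwa [Real.norm_of_nonneg hr0]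
  have h1r : 0 < 1 - r := by linarith
  have hgeo := hasSum_geometric_of_lt_one hr0 hr1
  have hlin : HasSum (fun n : ℕ ↦ (c * n + d) * r ^ n) (c * (r / (1 - r) ^ 2) + d * (1 - r)⁻¹) := by
    simpa only [add_mul, mul_assoc] using
      ((hasSum_coe_mul_geometric_of_norm_lt_one hr).mul_left c).add (hgeo.mul_left d)
  have hsum : Summable fun n ↦ a n * r ^ n := by
    refine .of_nonneg_of_le (fun n ↦ by have := ha n; positivity) (fun n ↦ ?_) hlin.summable
    gcongr
    exact (Finset.single_le_sum (fun i _ ↦ ha i) (Finset.self_mem_range_succ n)).trans (hS n)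
  refine ⟨hsum, ?_⟩
  have hcauchy := tsum_mul_tsum_eq_tsum_sum_range_of_summable_norm hsum.norm hgeo.summable.norm
  have hS' : ∀ n, ∑ k ∈ Finset.range (n + 1), a k * r ^ k * r ^ (n - k) =
      (∑ k ∈ Finset.range (n + 1), a k) * r ^ n := by
    intro n
    rw [Finset.sum_mul]
    refine Finset.sum_congr rfl fun k hk ↦ ?_
    rw [mul_assoc, ← pow_add, Nat.add_sub_cancel' (Finset.mem_range_succ_iff.1 hk)]
  simp_rw [hS', hgeo.tsum_eq] at hcauchy
  have hle : ∑' n, (∑ k ∈ Finset.range (n + 1), a k) * r ^ n ≤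
      c * (r / (1 - r) ^ 2) + d * (1 - r)⁻¹ := by
    rw [← hlin.tsum_eq]
    have hle' : ∀ n, (∑ k ∈ Finset.range (n + 1), a k) * r ^ n ≤ (c * n + d) * r ^ n := fun n ↦ by
      gcongr; exact hS n
    refine Summable.tsum_le_tsum hle' ?_ hlin.summable
    exact .of_nonneg_of_le
      (fun n ↦ mul_nonneg (Finset.sum_nonneg fun k _ ↦ ha k) (by positivity)) hle' hlin.summable
  rw [← hcauchy, ← div_eq_mul_inv, div_le_iff₀ h1r] at hle
  refine hle.trans_eq ?_
  field_simp

lemma sum_range_vonMangoldt (n : ℕ) :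
    ∑ k ∈ Finset.range (n + 1), ArithmeticFunction.vonMangoldt k = Chebyshev.psi n := by
  rw [Chebyshev.psi_eq_sum_Icc, Nat.floor_natCast, Nat.range_succ_eq_Icc_zero]

/-- The Laplace transform of the von Mangoldt function. -/
noncomputable def vonMangoldtLaplace (t : ℝ) : ℝ :=
  ∑' n : ℕ, ArithmeticFunction.vonMangoldt n * Real.exp (-n * t)

lemma vonMangoldtLaplace_nonneg (t : ℝ) : 0 ≤ vonMangoldtLaplace t :=
  tsum_nonneg fun _ ↦ mul_nonneg ArithmeticFunction.vonMangoldt_nonneg (Real.exp_pos _).le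

lemma exp_neg_natCast_mul (t : ℝ) (n : ℕ) : Real.exp (-n * t) = Real.exp (-t) ^ n := by
  rw [← Real.exp_nat_mul]; ring_nf

lemma summable_vonMangoldtLaplace {t : ℝ} (ht : 0 < t) :
    Summable fun n : ℕ ↦ ArithmeticFunction.vonMangoldt n * Real.exp (-n * t) := by
  simp_rw [exp_neg_natCast_mul]
  refine (summable_and_tsum_mul_pow_le (c := Real.log 4 + 4) (d := 0)
    (fun _ ↦ ArithmeticFunction.vonMangoldt_nonneg) (fun n ↦ ?_)
    (Real.exp_pos _).le (by simpa using ht)).1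
  rw [sum_range_vonMangoldt, add_zero]
  exact Chebyshev.psi_le_const_mul_self n.cast_nonneg

lemma vonMangoldtLaplace_le {t : ℝ} (ht : 0 < t) {k : ℕ} (hk : k ≠ 0) :
    vonMangoldtLaplace t ≤ (Real.log 4 + 4) * k.factorial / t ^ k := by
  have h := (summable_and_tsum_mul_pow_le (c := Real.log 4 + 4) (d := 0) (r := Real.exp (-t))
    (fun _ ↦ ArithmeticFunction.vonMangoldt_nonneg) (fun n ↦ by
      rw [sum_range_vonMangoldt, add_zero]
      exact Chebyshev.psi_le_const_mul_self n.cast_nonneg)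
    (Real.exp_pos _).le (by simpa using ht)).2
  simp_rw [← exp_neg_natCast_mul] at h
  have hexp : t ^ k / k.factorial + 1 ≤ Real.exp t := by
    have := Real.sum_le_exp_of_nonneg ht.le (k + 1)
    refine le_trans ?_ this
    rw [Finset.sum_range_succ, add_comm]
    gcongr
    have h1 : (1 : ℝ) = t ^ 0 / (Nat.factorial 0) := by simp
    rw [h1]
    exact Finset.single_le_sum (f := fun i ↦ t ^ i / (Nat.factorial i : ℝ))
      (fun i _ ↦ by positivity) (Finset.mem_range.2 (Nat.pos_of_ne_zero hk))
  have h2 : Real.exp (-t) / (1 - Real.exp (-t)) ≤ k.factorial / t ^ k := by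
    have h3 : 0 < t ^ k / k.factorial := by positivity
    have h4 : Real.exp (-t) / (1 - Real.exp (-t)) = (Real.exp t - 1)⁻¹ := by
      rw [Real.exp_neg]
      have : 0 < Real.exp t - 1 := by linarith
      have := Real.exp_pos t
      field_simp
    rw [h4, ← inv_div]
    exact inv_anti₀ h3 (by linarith)
  have hlog : 0 ≤ Real.log 4 := Real.log_nonneg (by norm_num)
  calc vonMangoldtLaplace t ≤ _ := h
    _ ≤ (Real.log 4 + 4) * (k.factorial / t ^ k) := by rw [add_zero]; gcongr
    _ = _ := by ring

/-- The Laplace transform of the von Mangoldt function in logarithmic scale, normalized so that it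
is bounded. -/
noncomputable def vonMangoldtMean (u : ℝ) : ℝ := Real.exp (-u) * vonMangoldtLaplace (Real.exp (-u))

lemma vonMangoldtMean_nonneg (u : ℝ) : 0 ≤ vonMangoldtMean u :=
  mul_nonneg (Real.exp_pos _).le (vonMangoldtLaplace_nonneg _)

lemma vonMangoldtMean_le (u : ℝ) : vonMangoldtMean u ≤ 6 * (Real.log 4 + 4) := by
  have h := vonMangoldtLaplace_le (Real.exp_pos (-u)) one_ne_zero
  have hlog : 0 ≤ Real.log 4 := Real.log_nonneg (by norm_num)
  simp only [Nat.factorial, pow_one, le_div_iff₀' (Real.exp_pos _)] at h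
  unfold vonMangoldtMean
  push_cast at h
  linarith

lemma vonMangoldtMean_le_mul_exp (u : ℝ) :
    vonMangoldtMean u ≤ 6 * (Real.log 4 + 4) * Real.exp (2 * u) := by
  have h := vonMangoldtLaplace_le (Real.exp_pos (-u)) three_ne_zero
  rw [le_div_iff₀' (by positivity)] at h
  have h2 : Real.exp (2 * u) * Real.exp (-u) ^ 2 = 1 := by
    rw [← Real.exp_nat_mul, ← Real.exp_add]; simp
  calc vonMangoldtMean u
      = Real.exp (2 * u) * (Real.exp (-u) ^ 3 * vonMangoldtLaplace (Real.exp (-u))) := by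
        unfold vonMangoldtMean; linear_combination
          -(Real.exp (-u) * vonMangoldtLaplace (Real.exp (-u))) * h2
    _ ≤ Real.exp (2 * u) * ((Real.log 4 + 4) * (Nat.factorial 3 : ℕ)) := by gcongr
    _ = _ := by simp only [Nat.factorial]; push_cast; ring

lemma lipschitzWith_vonMangoldtMean :
    LipschitzWith (Real.toNNReal (4 * (Real.log 4 + 4))) vonMangoldtMean := by
  have hlog : 0 ≤ Real.log 4 := Real.log_nonneg (by norm_num)
  let A : ℕ → ℝ → ℝ := fun N u ↦
    ∑ n ∈ Finset.range N, ArithmeticFunction.vonMangoldt n *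
      (Real.exp (-u) * Real.exp (-n * Real.exp (-u)))
  have hderiv : ∀ N u, HasDerivAt (A N) (∑ n ∈ Finset.range N, ArithmeticFunction.vonMangoldt n *
      (Real.exp (-u) * ((n * Real.exp (-u) - 1) * Real.exp (-n * Real.exp (-u))))) u := by
    intro N u
    refine HasDerivAt.fun_sum fun n _ ↦ HasDerivAt.const_mul _ ?_
    have h1 : HasDerivAt (fun u : ℝ ↦ Real.exp (-u)) (-Real.exp (-u)) u := by
      simpa using (hasDerivAt_neg u).exp
    convert! h1.mul (h1.const_mul (-n : ℝ)).exp using 1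
    ring
  have hlip : ∀ N, LipschitzWith (Real.toNNReal (4 * (Real.log 4 + 4))) (A N) := by
    intro N
    refine lipschitzWith_of_nnnorm_deriv_le (fun u ↦ (hderiv N u).differentiableAt) fun u ↦ ?_
    rw [(hderiv N u).deriv, ← NNReal.coe_le_coe, coe_nnnorm, Real.coe_toNNReal _ (by positivity)]
    have ht : 0 < Real.exp (-u) / 2 := by positivity
    have hterm : ∀ n : ℕ, ‖ArithmeticFunction.vonMangoldt n *
        (Real.exp (-u) * ((n * Real.exp (-u) - 1) * Real.exp (-n * Real.exp (-u))))‖ ≤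
        2 * Real.exp (-u) *
          (ArithmeticFunction.vonMangoldt n * Real.exp (-n * (Real.exp (-u) / 2))) := by
      intro n
      have hΛ : 0 ≤ ArithmeticFunction.vonMangoldt n := ArithmeticFunction.vonMangoldt_nonneg
      set x := n * Real.exp (-u) with hx
      have hx0 : 0 ≤ x := by positivity
      have e1 : -(n : ℝ) * Real.exp (-u) = -x := by rw [hx]; ring
      have e2 : -(n : ℝ) * (Real.exp (-u) / 2) = -(x / 2) := by rw [hx]; ring
      rw [e1, e2, norm_mul, norm_mul, norm_mul, Real.norm_of_nonneg hΛ,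
        Real.norm_of_nonneg (Real.exp_pos _).le, Real.norm_of_nonneg (Real.exp_pos _).le]
      have h1 : |x - 1| ≤ 2 * Real.exp (x / 2) := by
        have := Real.add_one_le_exp (x / 2)
        rw [abs_le]; constructor <;> linarith
      have h2 : Real.exp (x / 2) * Real.exp (-x) = Real.exp (-(x / 2)) := by
        rw [← Real.exp_add]; ring_nf
      calc _ ≤ ArithmeticFunction.vonMangoldt n *
            (Real.exp (-u) * (2 * Real.exp (x / 2) * Real.exp (-x))) := by
            rw [Real.norm_eq_abs]; gcongr
        _ = _ := by rw [mul_assoc 2, h2]; ring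
    have hL := vonMangoldtLaplace_le ht one_ne_zero
    simp only [Nat.factorial, pow_one, le_div_iff₀ ht] at hL
    calc _ ≤ ∑ n ∈ Finset.range N, 2 * Real.exp (-u) *
          (ArithmeticFunction.vonMangoldt n * Real.exp (-n * (Real.exp (-u) / 2))) :=
        norm_sum_le_of_le _ fun n _ ↦ hterm n
      _ ≤ 2 * Real.exp (-u) * vonMangoldtLaplace (Real.exp (-u) / 2) := by
        rw [← Finset.mul_sum]
        gcongr
        exact (summable_vonMangoldtLaplace ht).sum_le_tsum _ fun n _ ↦
          mul_nonneg ArithmeticFunction.vonMangoldt_nonneg (Real.exp_pos _).le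
      _ ≤ _ := by push_cast at hL; linarith
  have hlim : ∀ u, Tendsto (fun N ↦ A N u) atTop (𝓝 (vonMangoldtMean u)) := by
    intro u
    have := ((summable_vonMangoldtLaplace (Real.exp_pos (-u))).hasSum.mul_left
      (Real.exp (-u))).tendsto_sum_nat
    refine this.congr fun N ↦ Finset.sum_congr rfl fun n _ ↦ by ring
  exact LipschitzWith.of_dist_le_mul fun u v ↦
    le_of_tendsto ((hlim u).dist (hlim v)) (.of_forall fun N ↦ (hlip N).dist_le_mul u v)

lemma lipschitzWith_exp_neg_exp_neg :
    LipschitzWith 1 fun u : ℝ ↦ Real.exp (-Real.exp (-u)) := by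
  have hderiv : ∀ u : ℝ, HasDerivAt (fun u : ℝ ↦ Real.exp (-Real.exp (-u)))
      (Real.exp (-Real.exp (-u)) * Real.exp (-u)) u := by
    intro u
    simpa using (hasDerivAt_neg u).exp.neg.exp
  refine lipschitzWith_of_nnnorm_deriv_le (fun u ↦ (hderiv u).differentiableAt) fun u ↦ ?_
  rw [(hderiv u).deriv, ← NNReal.coe_le_coe, coe_nnnorm, Real.norm_of_nonneg (by positivity),
    Real.exp_neg, NNReal.coe_one, inv_mul_le_iff₀ (Real.exp_pos _)]
  linarith [Real.add_one_le_exp (Real.exp (-u))]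

lemma exp_neg_exp_neg_le_mul_exp (u : ℝ) :
    Real.exp (-Real.exp (-u)) ≤ 2 * Real.exp (2 * u) := by
  have h := Real.quadratic_le_exp_of_nonneg (Real.exp_pos (-u)).le
  have h2 : Real.exp (2 * u) * Real.exp (-u) ^ 2 = 1 := by
    rw [← Real.exp_nat_mul, ← Real.exp_add]; simp
  rw [Real.exp_neg, inv_le_iff_one_le_mul₀ (Real.exp_pos _)]
  have : Real.exp (-u) ^ 2 / 2 ≤ Real.exp (Real.exp (-u)) := by linarith [Real.exp_pos (-u)]
  calc (1 : ℝ) = 2 * Real.exp (2 * u) * (Real.exp (-u) ^ 2 / 2) := by linarith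
    _ ≤ _ := by gcongr

open MeasureTheory in
lemma integrable_exp_neg_mul_abs {ε : ℝ} (hε : 0 < ε) :
    Integrable fun u : ℝ ↦ Real.exp (-ε * |u|) := by
  rw [← integrableOn_univ, ← Set.Iic_union_Ioi (a := (0 : ℝ))]
  refine IntegrableOn.union ?_ ?_
  · refine (integrableOn_exp_mul_Iic hε 0).congr_fun (fun u hu ↦ ?_) measurableSet_Iic
    simp [abs_of_nonpos (Set.mem_Iic.1 hu)]
  · refine (integrableOn_exp_mul_Ioi (neg_neg_of_pos hε) 0).congr_fun (fun u hu ↦ ?_)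
      measurableSet_Ioi
    simp [abs_of_pos (Set.mem_Ioi.1 hu)]

lemma norm_exp_smul_le {g : ℝ → ℂ} {K : ℝ} (h1 : ∀ u, ‖g u‖ ≤ K)
    (h2 : ∀ u, ‖g u‖ ≤ K * Real.exp (2 * u)) {ε : ℝ} (hε : ε ∈ Set.Icc (0 : ℝ) 1) (u : ℝ) :
    ‖Real.exp (-ε * u) • g u‖ ≤ K * Real.exp (-ε * |u|) := by
  have hK : 0 ≤ K := (norm_nonneg _).trans (h1 0)
  rw [norm_smul, Real.norm_of_nonneg (Real.exp_pos _).le]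
  rcases le_total 0 u with hu | hu
  · rw [abs_of_nonneg hu, mul_comm]
    gcongr
    exact h1 u
  · calc _ ≤ Real.exp (-ε * u) * (K * Real.exp (2 * u)) := by gcongr; exact h2 u
      _ = K * Real.exp (-ε * u + 2 * u) := by rw [Real.exp_add]; ring
      _ ≤ _ := by
        rw [abs_of_nonpos hu]
        gcongr
        nlinarith [hε.2]

open MeasureTheory in
lemma integrable_exp_smul {g : ℝ → ℂ} {K : ℝ} (hg : Continuous g) (h1 : ∀ u, ‖g u‖ ≤ K)
    (h2 : ∀ u, ‖g u‖ ≤ K * Real.exp (2 * u)) {ε : ℝ} (hε : ε ∈ Set.Ioc (0 : ℝ) 1) :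
    Integrable fun u ↦ Real.exp (-ε * u) • g u :=
  ((integrable_exp_neg_mul_abs hε.1).const_mul K).mono'
    (Continuous.aestronglyMeasurable (by fun_prop))
    (.of_forall fun u ↦ norm_exp_smul_le h1 h2 ⟨hε.1.le, hε.2⟩ u)

open Complex ArithmeticFunction.vonMangoldt in
lemma mellin_vonMangoldtLaplace {s : ℂ} (hs : 1 < s.re) :
    mellin (fun t ↦ (vonMangoldtLaplace t : ℂ)) s =
      Gamma s * (LFunctionResidueClassAux (1 : ZMod 1) s + 1 / (s - 1)) := by
  have hsum := ArithmeticFunction.LSeriesSummable_vonMangoldt hs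
  have hM := hasSum_mellin (a := fun n : ℕ ↦ (ArithmeticFunction.vonMangoldt n : ℂ))
    (p := fun n : ℕ ↦ (n : ℝ)) (F := fun t ↦ (vonMangoldtLaplace t : ℂ)) (s := s)
    (fun n ↦ by
      rcases Nat.eq_zero_or_pos n with rfl | hn
      · simp
      · exact .inr (by exact_mod_cast hn))
    (by linarith)
    (fun t ht ↦ by
      have := (summable_vonMangoldtLaplace ht).hasSum
      simpa [vonMangoldtLaplace] using! Complex.hasSum_ofReal.2 this)
    (by
      refine hsum.norm.congr fun n ↦ ?_
      rw [LSeries.norm_term_eq]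
      split_ifs with h
      · simp [h]
      · rfl)
  have hres : residueClass (1 : ZMod 1) = fun n ↦ ArithmeticFunction.vonMangoldt n :=
    funext fun n ↦ Set.indicator_of_mem
      (show n ∈ {m : ℕ | (m : ZMod 1) = 1} from Subsingleton.elim _ _) _
  have heq := eqOn_LFunctionResidueClassAux (q := 1) (a := 1) isUnit_one hs
  simp only [Nat.totient_one, Nat.cast_one, inv_one, hres] at heq
  rw [heq, sub_add_cancel]
  refine hM.unique ((LSeriesSummable.LSeriesHasSum hsum).mul_left (Gamma s) |>.congr_fun ?_)
  intro n
  rw [LSeries.term_def]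
  split_ifs with h
  · simp [h]
  · simp [mul_div_assoc]

open MeasureTheory Complex in
open scoped FourierTransform in
lemma fourier_exp_smul_sub {ε : ℝ} (hε : 0 < ε) (t : ℝ) :
    𝓕 (fun u : ℝ ↦ Real.exp (-ε * u) • (vonMangoldtMean u : ℂ)) t -
      𝓕 (fun u : ℝ ↦ Real.exp (-ε * u) • (Real.exp (-Real.exp (-u)) : ℂ)) t =
    Gamma (1 + (ε + 2 * Real.pi * t * I)) *
      ArithmeticFunction.vonMangoldt.LFunctionResidueClassAux (1 : ZMod 1)
        (1 + (ε + 2 * Real.pi * t * I)) := by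
  set s : ℂ := ε + 2 * Real.pi * t * I with hs
  have hre : s.re = ε := by simp [hs]
  have him : s.im = 2 * Real.pi * t := by simp [hs]
  have hs0 : s ≠ 0 := fun h ↦ by simp [h] at hre; exact hε.ne hre
  have h1 := mellin_vonMangoldtLaplace (s := 1 + s) (by simp [hre, hε])
  have h2 : mellin (fun x ↦ (Real.exp (-x) : ℂ)) s = Gamma s := by
    rw [Gamma_eq_integral (by simpa [hre] using hε), GammaIntegral_eq_mellin]
  rw [mellin_eq_fourier] at h1 h2
  have e1 : (1 + s).im / (2 * Real.pi) = t := by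
    simp [him]
  have e2 : s.im / (2 * Real.pi) = t := by
    simp [him]
  rw [e1] at h1
  rw [e2, hre] at h2
  have e3 : (fun u : ℝ ↦ Real.exp (-(1 + s).re * u) • (vonMangoldtLaplace (Real.exp (-u)) : ℂ)) =
      fun u : ℝ ↦ Real.exp (-ε * u) • (vonMangoldtMean u : ℂ) := by
    ext u
    have : Real.exp (-(1 + s).re * u) = Real.exp (-ε * u) * Real.exp (-u) := by
      rw [← Real.exp_add]; simp [hre]; ring
    rw [this, vonMangoldtMean, mul_smul]
    simp
  rw [e3] at h1
  rw [h1, h2, add_sub_cancel_left, add_comm 1 s, Gamma_add_one _ hs0]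
  field_simp
  ring

open MeasureTheory Complex in
open scoped FourierTransform in
/-- The prime number theorem in Abel-Laplace form. -/
lemma tendsto_vonMangoldtMean : Tendsto vonMangoldtMean atTop (𝓝 1) := by
  set K := 6 * (Real.log 4 + 4) with hK
  have hlog : 0 ≤ Real.log 4 := Real.log_nonneg (by norm_num)
  let A : ℝ → ℂ := fun u ↦ vonMangoldtMean u
  let B : ℝ → ℂ := fun u ↦ (Real.exp (-Real.exp (-u)) : ℝ)
  have hAl : LipschitzWith _ A := isometry_ofReal.lipschitz.comp lipschitzWith_vonMangoldtMean
  have hBl : LipschitzWith _ B := isometry_ofReal.lipschitz.comp lipschitzWith_exp_neg_exp_neg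
  have hA1 : ∀ u, ‖A u‖ ≤ K := fun u ↦ by
    simpa [A, abs_of_nonneg (vonMangoldtMean_nonneg u)] using vonMangoldtMean_le u
  have hA2 : ∀ u, ‖A u‖ ≤ K * Real.exp (2 * u) := fun u ↦ by
    rw [Complex.norm_of_nonneg (vonMangoldtMean_nonneg u)]
    exact vonMangoldtMean_le_mul_exp u
  have hBn : ∀ u, ‖B u‖ = Real.exp (-Real.exp (-u)) := fun u ↦
    Complex.norm_of_nonneg (Real.exp_pos _).le
  have hB1 : ∀ u, ‖B u‖ ≤ 2 := fun u ↦ by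
    rw [hBn]
    have : Real.exp (-Real.exp (-u)) ≤ 1 := by simp [Real.exp_nonneg]
    linarith
  have hB2 : ∀ u, ‖B u‖ ≤ 2 * Real.exp (2 * u) := fun u ↦ by
    rw [hBn]; exact exp_neg_exp_neg_le_mul_exp u
  have hD1 : ∀ u, ‖(A - B) u‖ ≤ K + 2 := fun u ↦
    (norm_sub_le _ _).trans (add_le_add (hA1 u) (hB1 u))
  have hD2 : ∀ u, ‖(A - B) u‖ ≤ (K + 2) * Real.exp (2 * u) := fun u ↦
    (norm_sub_le _ _).trans ((add_le_add (hA2 u) (hB2 u)).trans_eq (by ring))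
  have hDl := hAl.sub hBl
  have hmain : Tendsto (A - B) atTop (𝓝 0) := by
    refine tendsto_zero_of_fourier_boundary (M := K + 2)
      (G := fun s ↦ Gamma (1 + s) *
        ArithmeticFunction.vonMangoldt.LFunctionResidueClassAux (1 : ZMod 1) (1 + s))
      hDl ?_ ?_ ?_ ?_
    · intro ε hε u
      refine (norm_exp_smul_le hD1 hD2 hε u).trans ?_
      refine mul_le_of_le_one_right (by positivity) ?_
      have := mul_nonneg hε.1 (abs_nonneg u)
      simpa using this
    · exact fun ε hε ↦ integrable_exp_smul hDl.continuous hD1 hD2 hε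
    · refine ContinuousOn.mul ?_ ?_
      · intro s hs
        have : ContinuousAt (fun s : ℂ ↦ Gamma (1 + s)) s := by
          refine ContinuousAt.comp (f := fun s : ℂ ↦ 1 + s) ?_ (by fun_prop)
          refine (differentiableAt_Gamma _ fun m h ↦ ?_).continuousAt
          have h' := congrArg re h
          simp at h'
          have : (0 : ℝ) ≤ m := m.cast_nonneg
          have : 0 ≤ s.re := hs
          linarith
        exact this.continuousWithinAt
      · refine ArithmeticFunction.vonMangoldt.continuousOn_LFunctionResidueClassAux
          (1 : ZMod 1) |>.comp (by fun_prop) fun s hs ↦ ?_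
        simpa using hs
    · intro ε hε t
      rw [← fourier_exp_smul_sub hε.1]
      have hiA := integrable_exp_smul hAl.continuous hA1 hA2 hε
      have hiB := integrable_exp_smul hBl.continuous hB1 hB2 hε
      rw [Real.fourier_eq, Real.fourier_eq, Real.fourier_eq, ← integral_sub
        ((Real.fourierIntegral_convergent_iff t).2 hiA)
        ((Real.fourierIntegral_convergent_iff t).2 hiB)]
      simp only [Pi.sub_apply, smul_sub, A, B]
  have hre : Tendsto (fun u ↦ vonMangoldtMean u - Real.exp (-Real.exp (-u))) atTop (𝓝 0) := by
    have := (continuous_re.tendsto 0).comp hmain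
    simpa [A, B, Function.comp_def, -ofReal_exp] using this
  have hB : Tendsto (fun u : ℝ ↦ Real.exp (-Real.exp (-u))) atTop (𝓝 1) := by
    have := (Real.continuous_exp.tendsto _).comp
      (Real.tendsto_exp_neg_atTop_nhds_zero.neg)
    simpa [Function.comp_def] using this
  simpa using hre.add hB

lemma eventually_mem_Ioo_zero_one : ∀ᶠ z : ℝ in 𝓝[<] 1, z ∈ Set.Ioo (0 : ℝ) 1 :=
  Ioo_mem_nhdsLT one_pos

lemma tendsto_one_sub_div_neg_log :
    Tendsto (fun z : ℝ ↦ (1 - z) / -Real.log z) (𝓝[<] 1) (𝓝 1) := by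
  have h := (Real.hasDerivAt_log one_ne_zero).hasDerivWithinAt (s := Set.Iio 1)
  rw [hasDerivWithinAt_iff_tendsto_slope' (by simp)] at h
  have h' := h.inv₀ (by norm_num)
  simp only [inv_one] at h'
  refine h'.congr fun z ↦ ?_
  rw [slope_def_field, Real.log_one, sub_zero, inv_div, ← neg_sub z 1, neg_div_neg_eq]

lemma tendsto_one_sub_mul_tsum_vonMangoldt :
    Tendsto (fun z : ℝ ↦ (1 - z) * ∑' n, ArithmeticFunction.vonMangoldt n * z ^ n)
      (𝓝[<] 1) (𝓝 1) := by
  have hlog : Tendsto (fun z : ℝ ↦ -Real.log z) (𝓝[<] 1) (𝓝[>] 0) := by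
    refine tendsto_nhdsWithin_iff.2 ⟨?_, ?_⟩
    · have := (Real.continuousAt_log one_ne_zero).tendsto.neg
      simp only [Real.log_one, neg_zero] at this
      exact this.mono_left nhdsWithin_le_nhds
    · filter_upwards [eventually_mem_Ioo_zero_one] with z hz
      simpa using Real.log_neg hz.1 hz.2
  have hu : Tendsto (fun z : ℝ ↦ -Real.log (-Real.log z)) (𝓝[<] 1) atTop :=
    tendsto_neg_atBot_atTop.comp (Real.tendsto_log_nhdsGT_zero.comp hlog)
  have := tendsto_one_sub_div_neg_log.mul (tendsto_vonMangoldtMean.comp hu)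
  rw [one_mul] at this
  refine this.congr' ?_
  filter_upwards [eventually_mem_Ioo_zero_one] with z hz
  have hpos : 0 < -Real.log z := by linarith [Real.log_neg hz.1 hz.2]
  simp only [Function.comp_apply, vonMangoldtMean, neg_neg, Real.exp_log hpos, vonMangoldtLaplace,
    exp_neg_natCast_mul, Real.exp_log hz.1]
  rw [← mul_assoc, div_mul_cancel₀ _ hpos.ne']

lemma summable_vonMangoldt_mul_pow {z : ℝ} (hz : z ∈ Set.Ioo (0 : ℝ) 1) :
    Summable fun n : ℕ ↦ ArithmeticFunction.vonMangoldt n * z ^ n := by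
  have := summable_vonMangoldtLaplace (neg_pos.2 (Real.log_neg hz.1 hz.2))
  simpa only [exp_neg_natCast_mul, neg_neg, Real.exp_log hz.1] using this

lemma ite_prime_log_le_vonMangoldt (n : ℕ) :
    (if n.Prime then Real.log n else 0) ≤ ArithmeticFunction.vonMangoldt n := by
  split_ifs with h
  · exact (ArithmeticFunction.vonMangoldt_apply_prime h).ge
  · exact ArithmeticFunction.vonMangoldt_nonneg

lemma ite_prime_log_nonneg (n : ℕ) : 0 ≤ if n.Prime then Real.log n else 0 := by
  split_ifs
  · exact Real.log_natCast_nonneg n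
  · rfl

lemma summable_prime_log_mul_pow {z : ℝ} (hz : z ∈ Set.Ioo (0 : ℝ) 1) :
    Summable fun n : ℕ ↦ (if n.Prime then Real.log n else 0) * z ^ n := by
  have hz0 := hz.1.le
  refine .of_nonneg_of_le (fun n ↦ mul_nonneg (ite_prime_log_nonneg n) (by positivity))
    (fun n ↦ ?_) (summable_vonMangoldt_mul_pow hz)
  gcongr
  exact ite_prime_log_le_vonMangoldt n

lemma tendsto_one_sub_mul_tsum_prime_log :
    Tendsto (fun z : ℝ ↦ (1 - z) * ∑' n : ℕ, (if n.Prime then Real.log n else 0) * z ^ n)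
      (𝓝[<] 1) (𝓝 1) := by
  obtain ⟨C, hC⟩ := Chebyshev.psi_sub_theta_le_mul_sqrt
  set a : ℕ → ℝ := fun n ↦
    ArithmeticFunction.vonMangoldt n - if n.Prime then Real.log n else 0 with ha
  have ha0 : ∀ n, 0 ≤ a n := fun n ↦ sub_nonneg.2 (ite_prime_log_le_vonMangoldt n)
  have hS : ∀ n : ℕ, ∑ k ∈ Finset.range (n + 1), a k ≤ |C| * √n := by
    intro n
    rw [ha, Finset.sum_sub_distrib, sum_range_vonMangoldt, ← Finset.sum_filter,
      Nat.range_succ_eq_Icc_zero]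
    have := Chebyshev.theta_eq_sum_Icc n
    rw [Nat.floor_natCast] at this
    rw [← this]
    exact (hC n).trans (by gcongr; exact le_abs_self C)
  have hdiff : Tendsto (fun z : ℝ ↦ (1 - z) * ∑' n, a n * z ^ n) (𝓝[<] 1) (𝓝 0) := by
    have hub : Tendsto (fun z : ℝ ↦ 2 * |C| * √(1 - z)) (𝓝[<] 1) (𝓝 0) := by
      have : Continuous fun z : ℝ ↦ 2 * |C| * √(1 - z) := by fun_prop
      simpa using (this.tendsto 1).mono_left nhdsWithin_le_nhds
    refine squeeze_zero' ?_ ?_ hub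
    · filter_upwards [eventually_mem_Ioo_zero_one] with z hz
      have hz0 := hz.1.le
      exact mul_nonneg (by linarith [hz.2])
        (tsum_nonneg fun n ↦ mul_nonneg (ha0 n) (by positivity))
    · filter_upwards [eventually_mem_Ioo_zero_one] with z hz
      have h1z : 0 < 1 - z := by linarith [hz.2]
      set η := √(1 - z) with hη
      have hη0 : 0 < η := Real.sqrt_pos.2 h1z
      have hη2 : η ^ 2 = 1 - z := Real.sq_sqrt h1z.le
      have hb := (summable_and_tsum_mul_pow_le ha0 (c := |C| * η) (d := |C| / η) (fun n ↦ by
        refine (hS n).trans ?_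
        have h1 : √(n : ℝ) ≤ η * n + 1 / η := by
          have hs : √(n : ℝ) ^ 2 = n := Real.sq_sqrt n.cast_nonneg
          have h2 : √(n : ℝ) ≤ η * √(n : ℝ) ^ 2 + 1 / η := by
            have h3 := div_nonneg (sq_nonneg (η * √(n : ℝ) - 1)) hη0.le
            have h4 : (η * √(n : ℝ) - 1) ^ 2 / η = η * √(n : ℝ) ^ 2 + 1 / η - 2 * √(n : ℝ) := by
              field_simp
              ring
            linarith [Real.sqrt_nonneg (n : ℝ)]
          rwa [hs] at h2
        calc |C| * √n ≤ |C| * (η * n + 1 / η) := by gcongr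
          _ = _ := by ring) hz.1.le hz.2).2
      calc (1 - z) * ∑' n, a n * z ^ n ≤ (1 - z) * (|C| * η * (z / (1 - z)) + |C| / η) := by gcongr
        _ = |C| * η * z + |C| * (η ^ 2 / η) := by rw [hη2]; field_simp
        _ ≤ |C| * η * 1 + |C| * η := by
          gcongr
          · exact hz.2.le
          · rw [sq, mul_div_cancel_right₀ _ hη0.ne']
        _ = _ := by ring
  have := tendsto_one_sub_mul_tsum_vonMangoldt.sub hdiff
  rw [sub_zero] at this
  refine this.congr' ?_
  filter_upwards [eventually_mem_Ioo_zero_one] with z hz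
  have h1 := summable_vonMangoldt_mul_pow hz
  have h2 := summable_prime_log_mul_pow hz
  simp_rw [ha, sub_mul]
  rw [h1.tsum_sub h2]
  ring

lemma tendsto_log_one_div_one_sub :
    Tendsto (fun z : ℝ ↦ Real.log (1 / (1 - z))) (𝓝[<] 1) atTop := by
  have h : Tendsto (fun z : ℝ ↦ 1 - z) (𝓝[<] 1) (𝓝[>] 0) := by
    refine tendsto_nhdsWithin_iff.2 ⟨?_, ?_⟩
    · have : Continuous fun z : ℝ ↦ 1 - z := by fun_prop
      simpa using (this.tendsto 1).mono_left nhdsWithin_le_nhds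
    · filter_upwards [eventually_mem_Ioo_zero_one] with z hz
      simpa using hz.2
  simp_rw [one_div]
  exact Real.tendsto_log_atTop.comp (tendsto_inv_nhdsGT_zero.comp h)

lemma one_sub_eq_exp_neg_log {z : ℝ} (hz : z < 1) :
    1 - z = Real.exp (-Real.log (1 / (1 - z))) := by
  rw [one_div, Real.log_inv, neg_neg, Real.exp_log (by linarith)]

lemma tendsto_one_sub_mul_log :
    Tendsto (fun z : ℝ ↦ (1 - z) * Real.log (1 / (1 - z))) (𝓝[<] 1) (𝓝 0) := by
  refine ((Real.tendsto_pow_mul_exp_neg_atTop_nhds_zero 1).comp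
    tendsto_log_one_div_one_sub).congr' ?_
  filter_upwards [eventually_mem_Ioo_zero_one] with z hz
  simp only [Function.comp_apply, pow_one]
  rw [← one_sub_eq_exp_neg_log hz.2, mul_comm]

lemma summable_prime_pow {z : ℝ} (hz : z ∈ Set.Ioo (0 : ℝ) 1) :
    Summable fun n : ℕ ↦ if n.Prime then z ^ n else 0 := by
  have hz0 := hz.1.le
  refine .of_nonneg_of_le (fun n ↦ by positivity) (fun n ↦ ?_)
    (summable_geometric_of_lt_one hz0 hz.2)
  split_ifs
  · rfl
  · positivity

/-- Lower bound for the prime power series, from `log n ≤ log N + n / N` with `N = M / (1 - z)`. -/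
lemma one_sub_mul_tsum_prime_log_le {z M : ℝ} (hz : z ∈ Set.Ioo (0 : ℝ) 1) (hM : 0 < M) :
    (1 - z) * ∑' n : ℕ, (if n.Prime then Real.log n else 0) * z ^ n ≤
      (1 - z) * (∑' n : ℕ, if n.Prime then z ^ n else 0) *
        (Real.log (1 / (1 - z)) + Real.log M) + 1 / M := by
  have hz0 := hz.1.le
  have h1z : 0 < 1 - z := by linarith [hz.2]
  have hP := (summable_prime_pow hz).hasSum.mul_left (Real.log (1 / (1 - z)) + Real.log M)
  have hN := (hasSum_coe_mul_geometric_of_norm_lt_one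
    (by rw [Real.norm_of_nonneg hz0]; exact hz.2)).mul_left ((1 - z) / M)
  have hle := hasSum_le (fun n : ℕ ↦ by
    have hpos : 0 ≤ (1 - z) / M * (n * z ^ n) := by positivity
    split_ifs with h
    · have hn : (0 : ℝ) < n := by exact_mod_cast h.pos
      have hlog := Real.log_le_sub_one_of_pos (show 0 < (1 - z) * n / M by positivity)
      rw [Real.log_div (by positivity) hM.ne', Real.log_mul h1z.ne' hn.ne'] at hlog
      have h' : Real.log n ≤ Real.log (1 / (1 - z)) + Real.log M + (1 - z) / M * n := by
        rw [one_div, Real.log_inv]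
        have : (1 - z) * n / M = (1 - z) / M * n := by ring
        linarith
      calc Real.log n * z ^ n
          ≤ (Real.log (1 / (1 - z)) + Real.log M + (1 - z) / M * n) * z ^ n := by gcongr
        _ = (Real.log (1 / (1 - z)) + Real.log M) * z ^ n + (1 - z) / M * (n * z ^ n) := by ring
    · simpa using hpos) (summable_prime_log_mul_pow hz).hasSum (hP.add hN)
  calc _ ≤ (1 - z) * _ := mul_le_mul_of_nonneg_left hle h1z.le
    _ = (1 - z) * (∑' n : ℕ, if n.Prime then z ^ n else 0) *
        (Real.log (1 / (1 - z)) + Real.log M) + z * (1 / M) := by field_simp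
    _ ≤ _ := by
      gcongr
      exact mul_le_of_le_one_left (by positivity) hz.2.le

lemma tsum_prime_pow_le {z Y : ℝ} (hz : z ∈ Set.Ioo (0 : ℝ) 1) (hY : 1 < Y) :
    (∑' n : ℕ, if n.Prime then z ^ n else 0) ≤
      Y + 1 + (∑' n : ℕ, (if n.Prime then Real.log n else 0) * z ^ n) / Real.log Y := by
  have hz0 := hz.1.le
  have hlogY : 0 < Real.log Y := Real.log_pos hY
  have h1 : HasSum (fun n : ℕ ↦ if n ∈ Finset.range (⌊Y⌋₊ + 1) then (1 : ℝ) else 0)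
      (⌊Y⌋₊ + 1 : ℕ) := by
    have h := hasSum_sum_of_ne_finset_zero (L := .unconditional ℕ)
      (s := Finset.range (⌊Y⌋₊ + 1))
      (f := fun n : ℕ ↦ if n ∈ Finset.range (⌊Y⌋₊ + 1) then (1 : ℝ) else 0)
      (fun n hn ↦ if_neg hn)
    rwa [Finset.sum_congr rfl (fun n hn ↦ if_pos hn), Finset.sum_const, Finset.card_range,
      nsmul_one] at h
  have hle := hasSum_le (fun n : ℕ ↦ by
    have hb := div_nonneg (mul_nonneg (ite_prime_log_nonneg n) (pow_nonneg hz0 n)) hlogY.le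
    by_cases hp : n.Prime
    · by_cases hn : n ∈ Finset.range (⌊Y⌋₊ + 1)
      · have := pow_le_one₀ hz0 hz.2.le (n := n)
        simp only [hp, hn, if_true] at hb ⊢
        exact this.trans (le_add_of_nonneg_right hb)
      · have hYn : Y < n := by
          rw [Finset.mem_range_succ_iff, not_le] at hn
          exact (Nat.floor_lt (by linarith)).1 hn
        have hlog : Real.log Y ≤ Real.log n := Real.log_le_log (by linarith) hYn.le
        simp only [hp, hn, if_true, if_false, zero_add]
        rw [le_div_iff₀ hlogY, mul_comm]
        gcongr
    · rw [if_neg hp]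
      exact add_nonneg (by positivity) hb)
    (summable_prime_pow hz).hasSum (h1.add ((summable_prime_log_mul_pow hz).hasSum.div_const _))
  have hfl := Nat.floor_le (show 0 ≤ Y by linarith)
  push_cast at hle
  exact hle.trans (by gcongr)

lemma tendsto_one_sub_mul_log_mul_tsum_prime_pow :
    Tendsto (fun z : ℝ ↦ (1 - z) * Real.log (1 / (1 - z)) *
      ∑' n : ℕ, if n.Prime then z ^ n else 0) (𝓝[<] 1) (𝓝 1) := by
  have hL := tendsto_log_one_div_one_sub
  have hT := tendsto_one_sub_mul_tsum_prime_log
  have hlogL : Tendsto (fun z : ℝ ↦ Real.log (Real.log (1 / (1 - z))) / Real.log (1 / (1 - z)))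
      (𝓝[<] 1) (𝓝 0) := Real.isLittleO_log_id_atTop.tendsto_div_nhds_zero.comp hL
  have hinv : Tendsto (fun z : ℝ ↦ 1 / Real.log (1 / (1 - z))) (𝓝[<] 1) (𝓝 0) := by
    simpa only [one_div, Function.comp_def] using tendsto_inv_atTop_zero.comp hL
  have hlow := (hT.sub hinv).div (hlogL.const_add 1) (by norm_num)
  have hup := (tendsto_one_sub_mul_log.add hinv).add
    (hT.mul ((hlogL.const_mul 2).const_sub 1 |>.inv₀ (by norm_num)))
  simp only [sub_zero, add_zero, div_one, mul_zero, inv_one, mul_one, zero_add] at hlow hup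
  have hsmall : ∀ᶠ z : ℝ in 𝓝[<] 1,
      Real.log (Real.log (1 / (1 - z))) / Real.log (1 / (1 - z)) < 1 / 2 :=
    hlogL.eventually_lt_const (by norm_num)
  refine tendsto_of_tendsto_of_tendsto_of_le_of_le' hlow hup ?_ ?_
  · filter_upwards [eventually_mem_Ioo_zero_one, hL.eventually_gt_atTop 1] with z hz hL1
    have h := one_sub_mul_tsum_prime_log_le hz (zero_lt_one.trans hL1)
    set L := Real.log (1 / (1 - z))
    have hlog : 0 < Real.log L := Real.log_pos hL1
    have hL0 : 0 < L := by linarith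
    rw [Pi.div_apply, div_le_iff₀ (by positivity)]
    have : (1 - z) * L * (∑' n : ℕ, if n.Prime then z ^ n else 0) * (1 + Real.log L / L) =
        (1 - z) * (∑' n : ℕ, if n.Prime then z ^ n else 0) * (L + Real.log L) := by
      field_simp
    rw [this]
    linarith
  · filter_upwards [eventually_mem_Ioo_zero_one, hL.eventually_gt_atTop 1, hsmall]
      with z hz hL1 hs
    have h1z : 0 < 1 - z := by linarith [hz.2]
    have he := one_sub_eq_exp_neg_log hz.2
    set L := Real.log (1 / (1 - z))
    have hL0 : 0 < L := by linarith
    have hs' : 0 < L - 2 * Real.log L := by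
      rw [div_lt_iff₀ hL0] at hs; linarith
    have h := tsum_prime_pow_le hz (Y := Real.exp (L - 2 * Real.log L)) (by simpa using hs')
    rw [Real.log_exp] at h
    have hY : (1 - z) * L * Real.exp (L - 2 * Real.log L) = 1 / L := by
      have h2 : Real.exp (2 * Real.log L) = L ^ 2 := by
        rw [mul_comm, Real.exp_mul, Real.exp_log hL0]; norm_num
      rw [he, Real.exp_sub, h2, Real.exp_neg]
      field_simp
    have hden : (1 - 2 * (Real.log L / L))⁻¹ = L / (L - 2 * Real.log L) := by
      rw [← inv_div]
      field_simp
    calc _ ≤ (1 - z) * L * _ := mul_le_mul_of_nonneg_left h (by positivity)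
      _ = _ := by
        rw [mul_add, mul_add, hY, hden]
        ring

lemma f_add_sq {z : ℝ} (hz : z ∈ Set.Ioo (0 : ℝ) 1) :
    f z + z ^ 2 = ∑' n : ℕ, if n.Prime then z ^ n else 0 := by
  rw [(summable_prime_pow hz).tsum_eq_add_tsum_ite 2, if_pos Nat.prime_two, add_comm, f]
  congr 2
  ext n
  by_cases h2 : n = 2
  · subst h2; simp [Nat.odd_iff]
  · by_cases hp : n.Prime
    · simp [hp, h2, hp.odd_of_ne_two h2]
    · simp [hp]

lemma f_nonneg {z : ℝ} (hz : 0 ≤ z) : 0 ≤ f z :=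
  tsum_nonneg fun n ↦ by positivity

lemma summable_f {z : ℝ} (hz : z ∈ Set.Ioo (0 : ℝ) 1) :
    Summable fun p : ℕ ↦ if p.Prime ∧ Odd p then z ^ p else 0 := by
  have hz0 := hz.1.le
  refine .of_nonneg_of_le (fun n ↦ by positivity) (fun n ↦ ?_) (summable_prime_pow hz)
  by_cases hp : n.Prime <;> by_cases ho : Odd n <;> simp [hp, ho, hz0]

lemma f_sq_le_f {z : ℝ} (hz : z ∈ Set.Ioo (0 : ℝ) 1) : f (z ^ 2) ≤ f z := by
  have hz0 := hz.1
  have hz1 := hz.2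
  refine Summable.tsum_le_tsum (fun n ↦ ?_)
    (summable_f ⟨by positivity, by nlinarith⟩) (summable_f hz)
  split_ifs
  · gcongr
    nlinarith
  · rfl

lemma tendsto_one_sub_mul_log_mul_f :
    Tendsto (fun z : ℝ ↦ (1 - z) * Real.log (1 / (1 - z)) * f z) (𝓝[<] 1) (𝓝 1) := by
  have hsq : Tendsto (fun z : ℝ ↦ z ^ 2) (𝓝[<] 1) (𝓝 1) := by
    simpa using ((continuous_pow 2).tendsto (1 : ℝ)).mono_left nhdsWithin_le_nhds
  have := tendsto_one_sub_mul_log_mul_tsum_prime_pow.sub (tendsto_one_sub_mul_log.mul hsq)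
  simp only [zero_mul, sub_zero] at this
  refine this.congr' ?_
  filter_upwards [eventually_mem_Ioo_zero_one] with z hz
  rw [← f_add_sq hz]
  ring

theorem f_sq_plus_f_sq_asymptotic :
    Tendsto (fun z : ℝ =>
        (1 - z) ^ 2 * (Real.log (1 / (1 - z))) ^ 2 * ((f z) ^ 2 + f (z ^ 2)))
      (𝓝[<] 1) (𝓝 1) := by
  have hmain := tendsto_one_sub_mul_log_mul_f
  have hsmall : Tendsto (fun z : ℝ ↦ (1 - z) ^ 2 * (Real.log (1 / (1 - z))) ^ 2 * f (z ^ 2))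
      (𝓝[<] 1) (𝓝 0) := by
    have hub := tendsto_one_sub_mul_log.mul hmain
    rw [zero_mul] at hub
    refine squeeze_zero' ?_ ?_ hub
    · exact .of_forall fun z ↦ mul_nonneg (by positivity) (f_nonneg (sq_nonneg z))
    · filter_upwards [eventually_mem_Ioo_zero_one] with z hz
      calc _ ≤ (1 - z) ^ 2 * (Real.log (1 / (1 - z))) ^ 2 * f z := by
            gcongr; exact f_sq_le_f hz
        _ = _ := by ring
  have := (hmain.pow 2).add hsmall
  rw [one_pow, add_zero] at this
  exact this.congr fun z ↦ by ring
end

section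
/- The number of ordered pairs (p, q) of primes with p + q ≤ 2n is asymptotically equivalent to 2n²/log²n as n → ∞, i.e. (#{(p,q) : p, q prime, p + q ≤ 2n})·log²n/(2n²) → 1. -/
open Filter Topology

section FourierLaplace

open MeasureTheory FourierTransform
open scoped Convolution ContDiff

lemma integrable_mul_cexp_neg {F : ℝ → ℝ} (hFm : Measurable F) {M : ℝ}
    (hM : ∀ u, |F u| ≤ M) (hF0 : ∀ u ≤ 0, F u = 0) {s : ℂ} (hs : 0 < s.re) :
    Integrable fun u : ℝ ↦ (F u : ℂ) * Complex.exp (-s * u) := by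
  have hexp : Integrable ((Set.Ioi (0 : ℝ)).indicator fun u ↦ M * Real.exp (-s.re * u)) := by
    rw [integrable_indicator_iff measurableSet_Ioi]
    exact (integrableOn_exp_mul_Ioi (neg_lt_zero.2 hs) 0).const_mul M
  refine hexp.mono' (by fun_prop) (ae_of_all _ fun u ↦ ?_)
  rcases le_or_gt u 0 with hu | hu
  · rw [Set.indicator_of_notMem (by simpa using hu), hF0 u hu]
    simp
  · rw [Set.indicator_of_mem (by simpa using hu), norm_mul, Complex.norm_real, Complex.norm_exp]
    simp only [Complex.mul_re, Complex.neg_re, Complex.ofReal_re, Complex.neg_im,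
      Complex.ofReal_im, mul_zero, sub_zero]
    gcongr
    exact hM u

lemma integral_laplace_mul_eq {F : ℝ → ℝ} (hFm : Measurable F) {M : ℝ}
    (hM : ∀ u, |F u| ≤ M) (hF0 : ∀ u ≤ 0, F u = 0) {G : ℂ → ℂ}
    (hFG : ∀ s : ℂ, 0 < s.re → ∫ u : ℝ, (F u : ℂ) * Complex.exp (-s * u) = G s)
    {φ : ℝ → ℂ} (hφ : Integrable φ) {σ : ℝ} (hσ : 0 < σ) (y : ℝ) :
    ∫ t : ℝ, G (σ + 2 * Real.pi * t * Complex.I) * (Real.fourierChar (y * t) • φ t) =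
      ∫ u : ℝ, (F u : ℂ) * Complex.exp (-σ * u) * 𝓕 φ (u - y) := by
  have h1 : Integrable fun u : ℝ ↦ (F u : ℂ) * Complex.exp (-σ * u) :=
    integrable_mul_cexp_neg hFm hM hF0 (by simpa using hσ)
  have h2 : Integrable fun t : ℝ ↦ Real.fourierChar (y * t) • φ t := by
    have := (Real.fourierIntegral_convergent_iff (μ := volume) (f := φ) (-y)).2 hφ
    refine this.congr (ae_of_all _ fun t ↦ ?_)
    simp [mul_comm]
  have key := VectorFourier.integral_fourierIntegral_smul_eq_flip (L := innerₗ ℝ)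
    Real.continuous_fourierChar continuous_inner h1 h2
  simp only [flip_innerₗ] at key
  calc _ = _ := integral_congr_ae (ae_of_all _ fun t ↦ ?_)
    _ = _ := key
    _ = _ := integral_congr_ae (ae_of_all _ fun u ↦ ?_)
  · simp only [smul_eq_mul]
    congr 1
    rw [← hFG _ (by simpa using hσ)]
    refine integral_congr_ae (ae_of_all _ fun u ↦ ?_)
    simp only [innerₗ_apply_apply, RCLike.inner_apply, conj_trivial, Circle.smul_def, Real.fourierChar_apply, smul_eq_mul]
    rw [mul_left_comm, ← Complex.exp_add]
    congr 2
    push_cast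
    ring
  · simp only [smul_eq_mul]
    congr 1
    rw [Real.fourier_real_eq]
    refine integral_congr_ae (ae_of_all _ fun t ↦ ?_)
    simp only [innerₗ_apply_apply, RCLike.inner_apply, conj_trivial]
    rw [smul_smul, ← AddChar.map_add_eq_mul]
    congr 2
    ring

theorem tendsto_integral_mul_fourier_sub {F : ℝ → ℝ} (hFm : Measurable F) {M : ℝ}
    (hM : ∀ u, |F u| ≤ M) (hF0 : ∀ u ≤ 0, F u = 0) {G : ℂ → ℂ}
    (hG : ContinuousOn G {s | 0 ≤ s.re})
    (hFG : ∀ s : ℂ, 0 < s.re → ∫ u : ℝ, (F u : ℂ) * Complex.exp (-s * u) = G s)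
    {φ : ℝ → ℂ} (hφ : Continuous φ) (hφc : HasCompactSupport φ) (hφi : Integrable (𝓕 φ)) :
    Tendsto (fun y : ℝ ↦ ∫ u : ℝ, (F u : ℂ) * 𝓕 φ (u - y)) atTop (𝓝 0) := by
  have hM0 : 0 ≤ M := (abs_nonneg _).trans (hM 0)
  have hline : Continuous fun p : ℝ × ℝ ↦ (p.1 + 2 * Real.pi * p.2 * Complex.I : ℂ) := by fun_prop
  have hGσ (σ : ℝ) (hσ : 0 ≤ σ) :
      Continuous fun t : ℝ ↦ G (σ + 2 * Real.pi * t * Complex.I) :=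
    hG.comp_continuous (by fun_prop) (by simpa using hσ)
  have heq (y : ℝ) : ∫ t : ℝ, G (2 * Real.pi * t * Complex.I) * (Real.fourierChar (y * t) • φ t) =
      ∫ u : ℝ, (F u : ℂ) * 𝓕 φ (u - y) := by
    have hlim : ∀ᶠ σ : ℝ in 𝓝[>] 0, 0 < σ ∧ σ ≤ 1 :=
      Ioc_mem_nhdsGT zero_lt_one
    have hL : Tendsto (fun σ : ℝ ↦ ∫ t : ℝ, G (σ + 2 * Real.pi * t * Complex.I) *
        (Real.fourierChar (y * t) • φ t)) (𝓝[>] 0)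
        (𝓝 (∫ t : ℝ, G (2 * Real.pi * t * Complex.I) * (Real.fourierChar (y * t) • φ t))) := by
      have hK : IsCompact (Set.Icc (0 : ℝ) 1 ×ˢ tsupport φ) := isCompact_Icc.prod hφc
      have hGc : ContinuousOn (fun p : ℝ × ℝ ↦ G (p.1 + 2 * Real.pi * p.2 * Complex.I))
          (Set.Icc (0 : ℝ) 1 ×ˢ tsupport φ) :=
        hG.comp hline.continuousOn fun p hp ↦ by simpa using hp.1.1
      obtain ⟨C, hC⟩ := hK.exists_bound_of_continuousOn hGc
      refine tendsto_integral_filter_of_dominated_convergence (fun t ↦ C * ‖φ t‖) ?_ ?_ ?_ ?_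
      · filter_upwards [hlim] with σ hσ
        exact ((hGσ σ hσ.1.le).mul (by fun_prop)).aestronglyMeasurable
      · filter_upwards [hlim] with σ hσ
        refine ae_of_all _ fun t ↦ ?_
        rw [norm_mul, Circle.norm_smul]
        by_cases ht : t ∈ tsupport φ
        · gcongr
          exact hC (σ, t) ⟨⟨hσ.1.le, hσ.2⟩, ht⟩
        · simp [image_eq_zero_of_notMem_tsupport ht]
      · exact ((hφ.integrable_of_hasCompactSupport hφc).norm).const_mul C
      · refine ae_of_all _ fun t ↦ Tendsto.mul_const _ ?_
        have h0 := (hG (2 * Real.pi * t * Complex.I) (by simp)).tendsto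
        refine h0.comp (tendsto_nhdsWithin_iff.2 ⟨?_, ?_⟩)
        · have : Continuous fun σ : ℝ ↦ (σ + 2 * Real.pi * t * Complex.I : ℂ) := by fun_prop
          simpa using (this.tendsto 0).mono_left nhdsWithin_le_nhds
        · filter_upwards [hlim] with σ hσ
          simpa using hσ.1.le
    have hR : Tendsto (fun σ : ℝ ↦ ∫ u : ℝ, (F u : ℂ) * Complex.exp (-σ * u) * 𝓕 φ (u - y))
        (𝓝[>] 0) (𝓝 (∫ u : ℝ, (F u : ℂ) * 𝓕 φ (u - y))) := by
      refine tendsto_integral_filter_of_dominated_convergence (fun u ↦ M * ‖𝓕 φ (u - y)‖) ?_ ?_ ?_ ?_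
      · refine .of_forall fun σ ↦ ?_
        have := (hφi.comp_sub_right y).aestronglyMeasurable
        exact AEStronglyMeasurable.mul (by fun_prop) this
      · filter_upwards [hlim] with σ hσ
        refine ae_of_all _ fun u ↦ ?_
        rw [norm_mul, norm_mul]
        gcongr
        rcases le_or_gt u 0 with hu | hu
        · simpa [hF0 u hu] using hM0
        · rw [Complex.norm_real, Complex.norm_exp]
          have : Real.exp ((-σ * u : ℂ)).re ≤ 1 := by
            rw [Real.exp_le_one_iff]
            have := mul_pos hσ.1 hu
            simpa using this.le
          calc _ ≤ M * 1 := by gcongr; exact hM u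
            _ = M := mul_one M
      · exact ((hφi.comp_sub_right y).norm).const_mul M
      · refine ae_of_all _ fun u ↦ Tendsto.mul_const _ ?_
        have : Continuous fun σ : ℝ ↦ (F u : ℂ) * Complex.exp (-σ * u) := by fun_prop
        simpa using (this.tendsto 0).mono_left nhdsWithin_le_nhds
    refine tendsto_nhds_unique (hL.congr' ?_) hR
    filter_upwards [hlim] with σ hσ
    exact integral_laplace_mul_eq hFm hM hF0 hFG
      (hφ.integrable_of_hasCompactSupport hφc) hσ.1 y
  have hRL := (Real.tendsto_integral_exp_smul_cocompact
    fun t : ℝ ↦ G (2 * Real.pi * t * Complex.I) * φ t).comp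
      (tendsto_neg_atTop_atBot.mono_right atBot_le_cocompact)
  refine hRL.congr fun y ↦ ?_
  rw [← heq y]
  refine integral_congr_ae (ae_of_all _ fun t ↦ ?_)
  simp [mul_comm t y, Circle.smul_def, mul_left_comm]

/-- A nonnegative integrable kernel, positive on average, which is the Fourier transform of a
continuous compactly supported function. -/
lemma exists_nonneg_fourier_kernel : ∃ (φ : ℝ → ℂ) (K : ℝ → ℝ), Continuous φ ∧
    HasCompactSupport φ ∧ (∀ w, 𝓕 φ w = K w) ∧ (∀ w, 0 ≤ K w) ∧ Integrable K ∧ 0 < ∫ w, K w := by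
  let b : ContDiffBump (0 : ℝ) := ⟨1, 2, by norm_num, by norm_num⟩
  let η : ℝ → ℂ := fun t ↦ (b t : ℂ)
  have hηs : ContDiff ℝ ∞ η := Complex.ofRealCLM.contDiff.comp b.contDiff
  have hηc : HasCompactSupport η := b.hasCompactSupport.comp_left Complex.ofReal_zero
  have hηi : Integrable η := hηs.continuous.integrable_of_hasCompactSupport hηc
  let S : SchwartzMap ℝ ℂ := 𝓕 (hηc.toSchwartzMap hηs)
  have hS (w : ℝ) : S w = 𝓕 η w := by
    simp only [S]
    rw [SchwartzMap.fourier_coe]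
    rfl
  have hreal (w : ℝ) : starRingEnd ℂ (𝓕 η w) = 𝓕 η w := by
    rw [Real.fourier_real_eq_integral_exp_smul, ← integral_conj, ← integral_neg_eq_self]
    refine integral_congr_ae (ae_of_all _ fun t ↦ ?_)
    simp only [smul_eq_mul, map_mul, ← Complex.exp_conj, η, b.neg, Complex.conj_ofReal,
      Complex.conj_I]
    congr 2
    push_cast
    ring
  have hsq (w : ℝ) : 𝓕 η w * 𝓕 η w = ((‖S w‖ ^ 2 : ℝ) : ℂ) := by
    nth_rewrite 1 [← hreal w]
    rw [hS, Complex.conj_mul']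
    push_cast
    rfl
  have hSi : Integrable fun w ↦ ‖S w‖ ^ 2 := (memLp_two_iff_integrable_sq_norm
    S.continuous.aestronglyMeasurable).1 (S.memLp 2)
  refine ⟨η ⋆[ContinuousLinearMap.mul ℂ ℂ, volume] η, fun w ↦ ‖S w‖ ^ 2,
    hηc.continuous_convolution_right _ hηi.locallyIntegrable hηs.continuous,
    hηc.convolution _ hηc, fun w ↦ ?_, fun w ↦ by positivity, hSi, ?_⟩
  · rw [Real.fourier_mul_convolution_eq hηi hηi, hsq]
  · refine integral_pos_of_integrable_nonneg_nonzero (x := 0)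
      (by fun_prop) hSi (fun w ↦ by positivity) ?_
    have h0 : S 0 = ((∫ t, b t : ℝ) : ℂ) := by
      rw [hS, Real.fourier_real_eq_integral_exp_smul]
      simp [η, integral_complex_ofReal]
    have := b.integral_pos (μ := volume)
    rw [h0]
    simpa using this.ne'

/-- A function `F` satisfying the Laplace transform hypotheses cannot stay above `ε > 0` on
intervals of fixed length arbitrarily far to the right. -/
theorem eventually_exists_mem_Icc_lt {F : ℝ → ℝ} (hFm : Measurable F) {M : ℝ}
    (hM : ∀ u, |F u| ≤ M) (hF0 : ∀ u ≤ 0, F u = 0) {G : ℂ → ℂ}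
    (hG : ContinuousOn G {s | 0 ≤ s.re})
    (hFG : ∀ s : ℂ, 0 < s.re → ∫ u : ℝ, (F u : ℂ) * Complex.exp (-s * u) = G s)
    {ε δ : ℝ} (hε : 0 < ε) (hδ : 0 < δ) :
    ∀ᶠ c in atTop, ∃ u ∈ Set.Icc (c - δ) (c + δ), F u < ε := by
  obtain ⟨φ, K, hφ, hφc, hφK, hK0, hKi, hKpos⟩ := exists_nonneg_fourier_kernel
  let w (R v : ℝ) : ℝ := if |v| ≤ R * δ then ε else -M
  have hM0 : 0 ≤ M := (abs_nonneg _).trans (hM 0)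
  have hwm (R : ℝ) : Measurable (w R) :=
    Measurable.ite (measurableSet_le (by fun_prop) (by fun_prop)) (by fun_prop) (by fun_prop)
  have hw (R v : ℝ) : |w R v| ≤ ε + M := by
    simp only [w]
    split_ifs
    · rw [abs_of_pos hε]; linarith
    · rw [abs_neg, abs_of_nonneg hM0]; linarith
  have hwK (R : ℝ) : Integrable fun v ↦ w R v * K v :=
    hKi.bdd_mul (hwm R).aestronglyMeasurable (ae_of_all _ (hw R))
  have hlim : Tendsto (fun R : ℝ ↦ ∫ v, w R v * K v) atTop (𝓝 (∫ v, ε * K v)) := by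
    refine tendsto_integral_filter_of_dominated_convergence (fun v ↦ (ε + M) * K v)
      (.of_forall fun R ↦ (hwK R).aestronglyMeasurable) (.of_forall fun R ↦ ae_of_all _ fun v ↦ ?_)
      (hKi.const_mul _) (ae_of_all _ fun v ↦ ?_)
    · rw [norm_mul, Real.norm_of_nonneg (hK0 v)]
      exact mul_le_mul_of_nonneg_right (hw R v) (hK0 v)
    · refine tendsto_const_nhds.congr' ?_
      filter_upwards [eventually_ge_atTop (|v| / δ)] with R hR
      simp only [w]
      rw [if_pos ((div_le_iff₀ hδ).1 hR)]
  rw [integral_const_mul] at hlim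
  obtain ⟨R, hRI, hR⟩ :=
    ((hlim.eventually (lt_mem_nhds (mul_pos hε hKpos))).and (eventually_gt_atTop 0)).exists
  have hscale (v : ℝ) : 𝓕 (fun t ↦ φ (R⁻¹ * t)) v = ((R * K (R * v) : ℝ) : ℂ) := by
    rw [Complex.ofReal_mul, ← hφK, Real.fourier_real_eq_integral_exp_smul,
      Real.fourier_real_eq_integral_exp_smul]
    have := Measure.integral_comp_mul_left
      (fun t : ℝ ↦ Complex.exp (↑(-2 * Real.pi * t * (R * v)) * Complex.I) • φ t) R⁻¹
    rw [inv_inv, abs_of_pos hR, Complex.real_smul] at this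
    rw [← this]
    refine integral_congr_ae (ae_of_all _ fun t ↦ ?_)
    have : R⁻¹ * t * (R * v) = t * v := by field_simp
    simp only [mul_assoc (-2 * Real.pi)] at this ⊢
    rw [this]
  have hKR : Integrable fun v ↦ R * K (R * v) := (hKi.comp_mul_left' hR.ne').const_mul R
  have hT := tendsto_integral_mul_fourier_sub hFm hM hF0 hG hFG (φ := fun t ↦ φ (R⁻¹ * t))
    (by fun_prop) (hφc.comp_homeomorph (Homeomorph.mulLeft₀ R⁻¹ (inv_ne_zero hR.ne')))
    (hKR.ofReal.congr (ae_of_all _ fun v ↦ (hscale v).symm))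
  have hT' : Tendsto (fun c : ℝ ↦ ∫ u : ℝ, F u * (R * K (R * (u - c)))) atTop (𝓝 0) := by
    rw [← tendsto_ofReal_iff, Complex.ofReal_zero]
    refine (hT.congr fun c ↦ ?_)
    rw [← integral_complex_ofReal]
    simp only [hscale, Complex.ofReal_mul]
  have hlow : 0 < ∫ v, w R (R * v) * (R * K (R * v)) := by
    have := Measure.integral_comp_mul_left (fun v ↦ w R v * (R * K v)) R
    rw [this, smul_eq_mul]
    simp only [mul_left_comm _ R]
    rw [integral_const_mul]
    positivity
  filter_upwards [hT'.eventually (gt_mem_nhds hlow), eventually_gt_atTop δ] with c hc hcδ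
  by_contra! hcon
  refine hc.not_ge ?_
  rw [← integral_sub_right_eq_self _ c]
  refine integral_mono ?_ ?_ fun u ↦ ?_
  · refine Integrable.comp_sub_right (f := fun v ↦ w R (R * v) * (R * K (R * v))) ?_ c
    exact hKR.bdd_mul ((hwm R).comp (by fun_prop)).aestronglyMeasurable
      (ae_of_all _ fun v ↦ hw R (R * v))
  · exact (hKR.comp_sub_right c).bdd_mul hFm.aestronglyMeasurable (ae_of_all _ hM)
  · refine mul_le_mul_of_nonneg_right ?_ (mul_nonneg hR.le (hK0 _))
    simp only [w]
    split_ifs with h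
    · rw [abs_mul, abs_of_pos hR] at h
      have := abs_le.1 (le_of_mul_le_mul_left h hR)
      exact hcon u ⟨by linarith, by linarith⟩
    · exact (abs_le.1 (hM u)).1

/-- A Tauberian theorem: if `exp u * B u` is monotone, `B` is bounded and the Laplace transform of
`B - 1` extends continuously to the closed right half plane, then `B` tends to `1`. -/
theorem tendsto_one_of_laplace {B : ℝ → ℝ} (hB : Monotone fun u ↦ Real.exp u * B u) {M : ℝ}
    (hM : ∀ u, |B u| ≤ M) {G : ℂ → ℂ} (hG : ContinuousOn G {s | 0 ≤ s.re})
    (hBG : ∀ s : ℂ, 0 < s.re →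
      ∫ u in Set.Ioi (0 : ℝ), ((B u - 1 : ℝ) : ℂ) * Complex.exp (-s * u) = G s) :
    Tendsto B atTop (𝓝 1) := by
  have hBm : Measurable B := by
    have : B = fun u ↦ Real.exp (-u) * (Real.exp u * B u) := by
      ext u
      rw [← mul_assoc, ← Real.exp_add]
      simp
    rw [this]
    exact (by fun_prop : Measurable fun u : ℝ ↦ Real.exp (-u)).mul hB.measurable
  have hstep {u v : ℝ} (h : u ≤ v) : B u ≤ Real.exp (v - u) * B v := by
    have := hB h
    rw [Real.exp_sub]
    have hu := Real.exp_pos u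
    rw [div_mul_eq_mul_div, le_div_iff₀ hu]
    simpa [mul_comm] using this
  let F : ℝ → ℝ := (Set.Ioi 0).indicator fun u ↦ B u - 1
  have hFm : Measurable F := (hBm.sub_const 1).indicator measurableSet_Ioi
  have hF0 (u : ℝ) (hu : u ≤ 0) : F u = 0 := Set.indicator_of_notMem (by simpa using hu) _
  have hFpos (u : ℝ) (hu : 0 < u) : F u = B u - 1 := Set.indicator_of_mem hu _
  have hM0 : 0 ≤ M := (abs_nonneg _).trans (hM 0)
  have hFM (u : ℝ) : |F u| ≤ M + 1 := by
    rcases le_or_gt u 0 with hu | hu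
    · rw [hF0 u hu, abs_zero]
      linarith
    · rw [hFpos u hu]
      exact (abs_sub _ _).trans (by simpa using hM u)
  have hFG (s : ℂ) (hs : 0 < s.re) : ∫ u : ℝ, (F u : ℂ) * Complex.exp (-s * u) = G s := by
    rw [← hBG s hs, ← integral_indicator measurableSet_Ioi]
    refine integral_congr_ae (ae_of_all _ fun u ↦ ?_)
    by_cases hu : u ∈ Set.Ioi (0 : ℝ) <;> simp [F, hu]
  have hFG' (s : ℂ) (hs : 0 < s.re) :
      ∫ u : ℝ, ((-F u : ℝ) : ℂ) * Complex.exp (-s * u) = -G s := by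
    simp only [Complex.ofReal_neg, neg_mul, integral_neg]
    rw [← hFG s hs]
    simp
  rw [Metric.tendsto_atTop']
  suffices h : ∀ ε : ℝ, 0 < ε → ε ≤ 1 → ∃ N, ∀ y > N, |B y - 1| < ε by
    intro ε hε
    obtain ⟨N, hN⟩ := h (min ε 1) (by positivity) (min_le_right _ _)
    exact ⟨N, fun y hy ↦ (hN y hy).trans_le (min_le_left _ _)⟩
  intro ε hε hε1
  set δ := ε / 16 with hδ
  have hδ0 : 0 < δ := by positivity
  have hexp : Real.exp (2 * δ) ≤ 1 + 4 * δ := by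
    have := Real.exp_bound_div_one_sub_of_interval (x := 2 * δ) (by linarith) (by linarith)
    refine this.trans ?_
    rw [div_le_iff₀ (by linarith)]
    nlinarith
  have h1 := eventually_exists_mem_Icc_lt hFm hFM hF0 hG hFG (half_pos hε) hδ0
  have h2 := eventually_exists_mem_Icc_lt hFm.neg (fun u ↦ (abs_neg (F u)).trans_le (hFM u))
    (fun u hu ↦ by simp [hF0 u hu]) hG.neg hFG' (half_pos hε) hδ0
  have h1' := (tendsto_atTop_add_const_right atTop δ tendsto_id).eventually h1
  have h2' := (tendsto_atTop_add_const_right atTop (-δ) tendsto_id).eventually h2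
  obtain ⟨N, hN⟩ := eventually_atTop.1 ((h1'.and h2').and (eventually_gt_atTop (2 * δ)))
  refine ⟨N, fun y hy ↦ ?_⟩
  obtain ⟨⟨⟨u, ⟨hu1, hu2⟩, huF⟩, ⟨v, ⟨hv1, hv2⟩, hvF⟩⟩, hyδ⟩ := hN y hy.le
  simp only [id] at hu1 hu2 hv1 hv2
  rw [hFpos u (by linarith)] at huF
  rw [Pi.neg_apply, hFpos v (by linarith)] at hvF
  have hyu := hstep (show y ≤ u by linarith)
  have hvy := hstep (show v ≤ y by linarith)
  have e1 : Real.exp (u - y) ≤ 1 + 4 * δ := (Real.exp_le_exp.2 (by linarith)).trans hexp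
  have e2 : Real.exp (y - v) ≤ 1 + 4 * δ := (Real.exp_le_exp.2 (by linarith)).trans hexp
  have p1 := Real.exp_pos (u - y)
  have p2 := Real.exp_pos (y - v)
  rw [abs_lt]
  constructor
  · by_contra! hcon
    nlinarith
  · by_contra! hcon
    nlinarith

end FourierLaplace

section PrimeNumberTheorem

open MeasureTheory Chebyshev ArithmeticFunction

lemma continuousOn_vonMangoldt_sub_pole :
    ∃ H : ℂ → ℂ, ContinuousOn H {s | 1 ≤ s.re} ∧ ∀ s : ℂ, 1 < s.re →
      H s = LSeries (fun n ↦ (Λ n : ℂ)) s - 1 / (s - 1) := by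
  refine ⟨vonMangoldt.LFunctionResidueClassAux (1 : ZMod 1),
    vonMangoldt.continuousOn_LFunctionResidueClassAux _, fun s hs ↦ ?_⟩
  rw [vonMangoldt.eqOn_LFunctionResidueClassAux isUnit_one hs]
  have h (n : ℕ) : vonMangoldt.residueClass (1 : ZMod 1) n = Λ n :=
    Set.indicator_of_mem (show n ∈ {m : ℕ | (m : ZMod 1) = 1} from Subsingleton.elim _ _) _
  simp [h]

lemma LSeries_vonMangoldt_eq_integral_psi {s : ℂ} (hs : 0 < s.re) :
    LSeries (fun n ↦ (Λ n : ℂ)) (1 + s) =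
      (1 + s) * ∫ u in Set.Ioi (0 : ℝ),
        ((psi (Real.exp u) * Real.exp (-u) : ℝ) : ℂ) * Complex.exp (-s * u) := by
  have hsum (x : ℝ) : ∑ k ∈ Finset.Icc 1 ⌊x⌋₊, Λ k = psi x := by
    simp [psi, ← Finset.Icc_add_one_left_eq_Ioc]
  rw [LSeries_eq_mul_integral_of_nonneg _ zero_le_one (by simpa using hs) ?_
    (fun n ↦ vonMangoldt_nonneg)]
  · rw [← Real.exp_zero, ← integral_comp_exp_Ioi]
    congr 1
    refine setIntegral_congr_fun measurableSet_Ioi fun u _ ↦ ?_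
    simp only [← Complex.ofReal_sum, hsum, Complex.real_smul]
    rw [Complex.cpow_def_of_ne_zero (by exact_mod_cast (Real.exp_pos u).ne'),
      ← Complex.ofReal_log (Real.exp_pos u).le, Real.log_exp]
    push_cast
    rw [mul_left_comm, ← Complex.exp_add, mul_assoc, ← Complex.exp_add]
    congr 2
    ring
  · refine Asymptotics.IsBigO.of_bound (Real.log 4 + 4) (.of_forall fun n ↦ ?_)
    have := hsum n
    rw [Nat.floor_natCast] at this
    rw [this, Real.norm_of_nonneg (psi_nonneg _), Real.rpow_one,
      Real.norm_of_nonneg n.cast_nonneg]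
    exact psi_le_const_mul_self n.cast_nonneg

/-- The **prime number theorem** for the Chebyshev function `ψ`. -/
theorem tendsto_psi_div : Tendsto (fun x ↦ psi x / x) atTop (𝓝 1) := by
  obtain ⟨H, hHc, hH⟩ := continuousOn_vonMangoldt_sub_pole
  let B (u : ℝ) : ℝ := psi (Real.exp u) * Real.exp (-u)
  have hBexp (u : ℝ) : Real.exp u * B u = psi (Real.exp u) := by
    simp only [B]
    rw [mul_left_comm, ← Real.exp_add]
    simp
  have hmono : Monotone fun u ↦ Real.exp u * B u := by
    simp only [hBexp]
    exact psi_mono.comp Real.exp_monotone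
  have hBM (u : ℝ) : |B u| ≤ Real.log 4 + 4 := by
    have := psi_le_const_mul_self (Real.exp_pos u).le
    rw [abs_of_nonneg (mul_nonneg (psi_nonneg _) (Real.exp_pos _).le)]
    rwa [← hBexp, mul_comm, mul_le_mul_iff_left₀ (Real.exp_pos u)] at this
  have hBm : Measurable B := (psi_mono.measurable.comp (by fun_prop)).mul (by fun_prop)
  have hB : Tendsto B atTop (𝓝 1) := by
    refine tendsto_one_of_laplace hmono hBM (G := fun s ↦ (H (1 + s) - 1) / (1 + s)) ?_ ?_
    · have h1 : ContinuousOn (fun s : ℂ ↦ H (1 + s)) {s | 0 ≤ s.re} :=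
        hHc.comp (by fun_prop) fun s hs ↦ by simpa using hs
      refine (h1.sub continuousOn_const).div (by fun_prop) fun s hs h ↦ ?_
      have := congrArg Complex.re h
      simp only [Complex.add_re, Complex.one_re, Complex.zero_re, Set.mem_ofPred_eq] at this hs
      linarith
    · intro s hs
      have hs0 : s ≠ 0 := fun h ↦ by simp [h] at hs
      have hs1 : 1 + s ≠ 0 := fun h ↦ by
        have := congrArg Complex.re h
        simp only [Complex.add_re, Complex.one_re, Complex.zero_re] at this
        linarith
      have hI1 : IntegrableOn (fun u : ℝ ↦ (B u : ℂ) * Complex.exp (-s * u)) (Set.Ioi 0) := by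
        rw [← integrable_indicator_iff measurableSet_Ioi]
        refine (integrable_mul_cexp_neg (F := (Set.Ioi 0).indicator B) (M := Real.log 4 + 4)
          (hBm.indicator measurableSet_Ioi) (fun u ↦ ?_)
          (fun u hu ↦ Set.indicator_of_notMem (by simpa using hu) _) hs).congr
          (ae_of_all _ fun u ↦ ?_)
        · exact (norm_indicator_le_norm_self B u).trans (hBM u)
        · by_cases hu : u ∈ Set.Ioi (0 : ℝ) <;> simp [hu]
      have hs' : (-s).re < 0 := by simpa using hs
      have hI2 := integrableOn_exp_mul_complex_Ioi hs' 0
      have hsplit : ∫ u in Set.Ioi (0 : ℝ), ((B u - 1 : ℝ) : ℂ) * Complex.exp (-s * u) =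
          (∫ u in Set.Ioi (0 : ℝ), (B u : ℂ) * Complex.exp (-s * u)) -
            ∫ u in Set.Ioi (0 : ℝ), Complex.exp (-s * u) := by
        rw [← integral_sub hI1 hI2]
        simp [sub_mul]
      rw [hsplit, integral_exp_mul_complex_Ioi hs', hH _ (by simpa using hs),
        LSeries_vonMangoldt_eq_integral_psi hs]
      simp only [B, Complex.ofReal_zero, mul_zero, Complex.exp_zero, add_sub_cancel_left]
      field_simp
      ring
  refine (hB.comp Real.tendsto_log_atTop).congr' ?_
  filter_upwards [eventually_gt_atTop 0] with x hx
  simp [B, Real.exp_neg, Real.exp_log hx, div_eq_mul_inv]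

/-- The **prime number theorem** for the Chebyshev function `θ`. -/
theorem tendsto_theta_div : Tendsto (fun x ↦ theta x / x) atTop (𝓝 1) := by
  have h : Tendsto (fun x ↦ (psi x - theta x) / x) atTop (𝓝 0) := by
    refine (isBigO_psi_sub_theta_sqrt.trans_isLittleO ?_).tendsto_div_nhds_zero
    refine (Asymptotics.isLittleO_iff_tendsto' ?_).2 ?_
    · filter_upwards [eventually_gt_atTop 0] with x hx h0
      exact absurd h0 hx.ne'
    · simp_rw [Real.sqrt_div_self]
      exact Real.tendsto_sqrt_atTop.inv_tendsto_atTop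
  have := tendsto_psi_div.sub h
  rw [sub_zero] at this
  refine this.congr fun x ↦ ?_
  rw [← sub_div, sub_sub_cancel]

theorem tendsto_primeCounting_mul_log_sub_theta_div :
    Tendsto (fun N : ℕ ↦ (Nat.primeCounting N * Real.log N - theta N) / N) atTop (𝓝 0) := by
  have h := primeCounting_sub_theta_div_log_isBigO.mul
    (Asymptotics.isBigO_refl (fun x ↦ Real.log x / x) atTop)
  have h2 : (fun x : ℝ ↦ x / Real.log x ^ 2 * (Real.log x / x)) =ᶠ[atTop]
      fun x ↦ (Real.log x)⁻¹ := by
    filter_upwards [eventually_gt_atTop 1] with x hx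
    have := Real.log_pos hx
    field_simp
  have h3 := (h.trans_eventuallyEq h2).trans_tendsto Real.tendsto_log_atTop.inv_tendsto_atTop
  refine (h3.comp tendsto_natCast_atTop_atTop).congr' ?_
  filter_upwards [eventually_gt_atTop 1] with N hN
  have : 0 < Real.log N := Real.log_pos (by exact_mod_cast hN)
  simp only [Function.comp, Nat.floor_natCast]
  field_simp

open Finset Nat in
lemma primeCounting_mul_sub_theta (m : ℕ) (L : ℝ) :
    primeCounting m * L - theta m = ∑ p ∈ primesLE m, (L - Real.log p) := by
  rw [theta_eq_sum_primesLE_log, sum_sub_distrib, sum_const, primesLE_card_eq_primeCounting,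
    nsmul_eq_mul]

/-- A form of the **prime number theorem**: `π m` is `m / log N + o(N / log N)` uniformly
in `m ≤ N`. -/
theorem eventually_forall_le_abs_primeCounting_mul_log_sub_le {ε : ℝ} (hε : 0 < ε) :
    ∀ᶠ N : ℕ in atTop, ∀ m ≤ N, |Nat.primeCounting m * Real.log N - m| ≤ ε * N := by
  have hθ : ∀ᶠ x in atTop, |theta x / x - 1| < ε / 2 ∧ 0 < x :=
    (tendsto_theta_div.eventually (Metric.ball_mem_nhds 1 (half_pos hε))).and
      (eventually_gt_atTop 0)
  obtain ⟨x₀, hx₀⟩ := eventually_atTop.1 hθ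
  have hx₀pos : 0 < x₀ := (hx₀ x₀ le_rfl).2
  have hlog4 : Real.log 4 ≤ 3 := by
    have := Real.log_le_sub_one_of_pos (show (0 : ℝ) < 4 by norm_num)
    linarith
  have hN := tendsto_natCast_atTop_atTop.eventually (eventually_ge_atTop (6 * x₀ / ε))
  have hD := tendsto_primeCounting_mul_log_sub_theta_div.eventually
    (gt_mem_nhds (half_pos hε))
  filter_upwards [hN, hD, eventually_gt_atTop 0] with N hN hD hN0 m hm
  have hNpos : (0 : ℝ) < N := by exact_mod_cast hN0
  have hmN : (m : ℝ) ≤ N := by exact_mod_cast hm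
  rw [div_lt_iff₀ hNpos, primeCounting_mul_sub_theta] at hD
  rw [div_le_iff₀ hε] at hN
  have hterm : ∀ p ∈ Nat.primesLE N, 0 ≤ Real.log N - Real.log p := fun p hp ↦ by
    rw [Nat.mem_primesLE] at hp
    have : (0 : ℝ) < p := by exact_mod_cast hp.2.pos
    exact sub_nonneg.2 (Real.log_le_log this (by exact_mod_cast hp.1))
  have hsub : Nat.primesLE m ⊆ Nat.primesLE N := fun p hp ↦ by
    rw [Nat.mem_primesLE] at hp ⊢
    exact ⟨hp.1.trans hm, hp.2⟩
  have hπ := primeCounting_mul_sub_theta m (Real.log N)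
  have hle := Finset.sum_le_sum_of_subset_of_nonneg hsub fun p hp _ ↦ hterm p hp
  have hnn := Finset.sum_nonneg fun p hp ↦ hterm p (hsub hp)
  have hθm : |theta m - m| ≤ ε / 2 * N := by
    rcases le_or_gt x₀ m with h | h
    · obtain ⟨h1, h2⟩ := hx₀ m h
      have : theta m - m = (theta m / m - 1) * m := by field_simp
      rw [this, abs_mul, abs_of_pos h2]
      gcongr
    · have h1 := theta_nonneg m
      have h2 := theta_le_log4_mul_x (x := m) (by positivity)
      have h3 : (0 : ℝ) ≤ m := by positivity
      rw [abs_le]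
      constructor <;> nlinarith
  rw [abs_le] at hθm ⊢
  constructor <;> linarith [hθm.1, hθm.2]

open Finset Nat in
lemma card_prime_pairs_eq_sum (N : ℕ) :
    #{pq ∈ range (N + 1) ×ˢ range (N + 1) | pq.1.Prime ∧ pq.2.Prime ∧ pq.1 + pq.2 ≤ N} =
      ∑ p ∈ primesLE N, primeCounting (N - p) := by
  simp only [← primesLE_card_eq_primeCounting, ← card_sigma]
  refine card_bij' (fun x _ ↦ ⟨x.1, x.2⟩) (fun x _ ↦ (x.1, x.2)) ?_ ?_ ?_ ?_
  · rintro ⟨p, q⟩ h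
    simp only [mem_filter, mem_product, mem_range, mem_sigma, mem_primesLE] at h ⊢
    exact ⟨⟨by lia, h.2.1⟩, by lia, h.2.2.1⟩
  · rintro ⟨p, q⟩ h
    simp only [mem_filter, mem_product, mem_range, mem_sigma, mem_primesLE] at h ⊢
    exact ⟨by lia, h.1.2, h.2.2, by lia⟩
  · simp
  · simp

open Finset Nat in
lemma sum_primesLE_sub_eq_sum_primeCounting (N : ℕ) :
    ∑ p ∈ primesLE N, (N - p) = ∑ m ∈ range N, primeCounting m := by
  simp only [← primesLE_card_eq_primeCounting, ← Nat.card_Ico, ← card_sigma]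
  refine card_bij' (fun x _ ↦ ⟨x.2, x.1⟩) (fun x _ ↦ ⟨x.2, x.1⟩) ?_ ?_ ?_ ?_
  · rintro ⟨p, m⟩ h
    simp only [mem_sigma, mem_primesLE, mem_Ico, mem_range] at h ⊢
    exact ⟨h.2.2, h.2.1, h.1.2⟩
  · rintro ⟨m, p⟩ h
    simp only [mem_sigma, mem_primesLE, mem_Ico, mem_range] at h ⊢
    exact ⟨⟨by lia, h.2.2⟩, h.2.1, h.1⟩
  · simp
  · simp

open Finset Nat in
theorem tendsto_card_prime_pairs_mul_log_sq_div :
    Tendsto (fun N : ℕ ↦ ((∑ p ∈ primesLE N, primeCounting (N - p) : ℕ) : ℝ) *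
      Real.log N ^ 2 / N ^ 2) atTop (𝓝 (1 / 2)) := by
  rw [Metric.tendsto_atTop]
  suffices h : ∀ ε : ℝ, 0 < ε → ε ≤ 1 → ∀ᶠ N : ℕ in atTop,
      |((∑ p ∈ primesLE N, primeCounting (N - p) : ℕ) : ℝ) * Real.log N ^ 2 / N ^ 2 - 1 / 2| ≤
        4 * ε by
    intro ε hε
    have hmin : 0 < min (ε / 5) 1 := by positivity
    refine eventually_atTop.1 ((h _ hmin (min_le_right _ _)).mono fun N hN ↦ ?_)
    have := min_le_left (ε / 5) 1
    exact hN.trans_lt (by linarith)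
  intro ε hε hε1
  filter_upwards [eventually_forall_le_abs_primeCounting_mul_log_sub_le hε,
    tendsto_natCast_atTop_atTop.eventually (eventually_ge_atTop (1 / ε)),
    eventually_gt_atTop 1] with N hunif hN hN1
  have hNpos : (1 : ℝ) < N := by exact_mod_cast hN1
  set L := Real.log N with hL
  have hLpos : 0 < L := Real.log_pos hNpos
  have hπN := abs_le.1 (hunif N le_rfl)
  have h1 : |∑ p ∈ primesLE N, ((primeCounting (N - p) : ℝ) * L - ((N - p : ℕ) : ℝ))| ≤
      primeCounting N * (ε * N) := by
    refine (abs_sum_le_sum_abs _ _).trans ?_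
    rw [← primesLE_card_eq_primeCounting, ← nsmul_eq_mul]
    exact sum_le_card_nsmul _ _ _ fun p _ ↦ hunif _ (N.sub_le p)
  have h2 : |∑ m ∈ range N, ((primeCounting m : ℝ) * L - m)| ≤ N * (ε * N) := by
    refine (abs_sum_le_sum_abs _ _).trans ?_
    refine (sum_le_card_nsmul (range N) _ (ε * N) fun m hm ↦
      hunif m (mem_range.1 hm).le).trans_eq ?_
    rw [card_range, nsmul_eq_mul]
  rw [sum_sub_distrib, ← sum_mul, ← Nat.cast_sum, ← Nat.cast_sum,
    sum_primesLE_sub_eq_sum_primeCounting] at h1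
  have hgauss : (∑ m ∈ range N, (m : ℝ)) = N * (N - 1) / 2 := by
    rw [eq_div_iff two_ne_zero, ← Nat.cast_sum]
    have := sum_range_id_mul_two N
    rw [← Nat.cast_pred (by lia : 0 < N)]
    exact_mod_cast this
  rw [sum_sub_distrib, ← sum_mul, ← Nat.cast_sum, hgauss] at h2
  set P := ((∑ p ∈ primesLE N, primeCounting (N - p) : ℕ) : ℝ)
  set S := ((∑ m ∈ range N, primeCounting m : ℕ) : ℝ)
  rw [div_le_iff₀ hε] at hN
  have h1' : |P * L ^ 2 - S * L| ≤ 2 * N * (ε * N) := by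
    have hπ : primeCounting N * L ≤ 2 * N := by nlinarith [hπN.2]
    have : P * L ^ 2 - S * L = (P * L - S) * L := by ring
    rw [this, abs_mul, abs_of_pos hLpos]
    calc _ ≤ primeCounting N * (ε * N) * L := by gcongr
      _ = primeCounting N * L * (ε * N) := by ring
      _ ≤ 2 * N * (ε * N) := mul_le_mul_of_nonneg_right hπ (by positivity)
  have hfin : |P * L ^ 2 - N ^ 2 / 2| ≤ 4 * ε * N ^ 2 := by
    rw [abs_le] at *
    constructor <;> nlinarith
  have : P * L ^ 2 / N ^ 2 - 1 / 2 = (P * L ^ 2 - N ^ 2 / 2) / N ^ 2 := by field_simp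
  rw [this, abs_div, abs_of_pos (by positivity : (0 : ℝ) < (N : ℝ) ^ 2),
    div_le_iff₀ (by positivity)]
  exact hfin

end PrimeNumberTheorem

theorem ordered_prime_pairs_asymptotic :
    Tendsto (fun n : ℕ =>
        ((((Finset.range (2 * n + 1) ×ˢ Finset.range (2 * n + 1)).filter
            (fun pq : ℕ × ℕ => Nat.Prime pq.1 ∧ Nat.Prime pq.2 ∧ pq.1 + pq.2 ≤ 2 * n)).card : ℝ) *
          (Real.log n) ^ 2 / (2 * (n : ℝ) ^ 2)))
      atTop (𝓝 1) := by
  simp only [card_prime_pairs_eq_sum]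
  have h2n : Tendsto (fun n : ℕ ↦ 2 * n) atTop atTop :=
    tendsto_id.const_mul_atTop' two_pos
  have h := tendsto_card_prime_pairs_mul_log_sq_div.comp h2n
  have hlog : Tendsto (fun n : ℕ ↦ Real.log n / Real.log (2 * n)) atTop (𝓝 1) := by
    have hL := Real.tendsto_log_atTop.comp (tendsto_natCast_atTop_atTop (R := ℝ))
    have h1 : Tendsto (fun n : ℕ ↦ (1 + Real.log 2 / Real.log n)⁻¹) atTop (𝓝 1) := by
      simpa using ((hL.const_div_atTop (Real.log 2)).const_add 1).inv₀ (by norm_num)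
    refine h1.congr' ?_
    filter_upwards [eventually_gt_atTop 1] with n hn
    have hn' : (1 : ℝ) < n := by exact_mod_cast hn
    have := Real.log_pos hn'
    have := Real.log_pos one_lt_two
    rw [Real.log_mul two_ne_zero (by linarith)]
    field_simp
    ring
  have hmul := ((h.const_mul 2).mul (hlog.pow 2))
  norm_num at hmul
  refine hmul.congr' ?_
  filter_upwards [eventually_gt_atTop 0] with n hn
  have hn' : (1 : ℝ) ≤ n := by exact_mod_cast hn
  have := Real.log_pos (show (1 : ℝ) < 2 * n by linarith)
  push_cast
  field_simp
end
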